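/- Let n ≥ 2, let K ⊂ ℝⁿ be a compact convex set with |K| = |D_n|, and let ε ∈ (0, 1/2). Then there exist a natural number N with N ≤ C·n⁴·(log ε)², where C > 0 is a universal constant, and unit vectors u₁, …, u_N ∈ S^{n−1}, such that the body K' = S_{u_N}(⋯(S_{u₁}(K))⋯) obtained by successively applying the Steiner symmetrizations in directions u₁, …, u_N satisfies (1−ε)·D_n ⊆ K' ⊆ (1+ε)·D_n. -/

import Mathlib

open MeasureTheory Pointwise Metric

/-- The Steiner symmetral of `K` in direction `u`. -/
noncomputable def steinerSymmetral {n : ℕ} (u : EuclideanSpace ℝ (Fin n))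
    (K : Set (EuclideanSpace ℝ (Fin n))) : Set (EuclideanSpace ℝ (Fin n)) :=
  {z | ∃ (y : EuclideanSpace ℝ (Fin n)) (t : ℝ), y ∈ (ℝ ∙ u)ᗮ ∧
      z = y + t • u ∧ (∃ s : ℝ, y + s • u ∈ K) ∧
      |t| ≤ (volume {s : ℝ | y + s • u ∈ K}).toReal / 2}

open scoped RealInnerProductSpace ENNReal

/-- `n`-dimensional Euclidean space. -/
abbrev Euc (n : ℕ) := EuclideanSpace ℝ (Fin n)

/-- The parameters of the points of `K` on the line through `y` in direction `u`. -/
def chord {n : ℕ} (u y : Euc n) (K : Set (Euc n)) : Set ℝ := {s | y + s • u ∈ K}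

theorem chord_eq_empty_or_Icc {n : ℕ} {u : Euc n} (hu : ‖u‖ = 1) {K : Set (Euc n)}
    (hK : IsCompact K) (hc : Convex ℝ K) (y : Euc n) :
    chord u y K = ∅ ∨ ∃ a b, a ≤ b ∧ chord u y K = Set.Icc a b := by
  rcases Set.eq_empty_or_nonempty (chord u y K) with h | h
  · exact Or.inl h
  right
  have hconv : Convex ℝ (chord u y K) := by
    intro s hs t ht a b ha hb hab
    have := hc hs ht ha hb hab
    simp only [chord, Set.mem_ofPred_eq, smul_eq_mul] at this ⊢
    convert this using 1
    rw [smul_add, smul_add, add_add_add_comm, ← add_smul, hab, one_smul, add_smul, mul_smul,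
      mul_smul]
  have hcomp : IsCompact (chord u y K) := by
    refine Metric.isCompact_of_isClosed_isBounded ?_ ?_
    · exact hK.isClosed.preimage (by fun_prop : Continuous fun s : ℝ => y + s • u)
    · obtain ⟨R, hR⟩ := hK.isBounded.exists_norm_le
      refine (Metric.isBounded_closedBall (x := (0 : ℝ)) (r := R + ‖y‖)).subset fun s hs => ?_
      rw [mem_closedBall_zero_iff]
      have h1 : ‖s • u‖ = ‖s‖ := by rw [norm_smul, hu, mul_one]
      have h2 : s • u = (y + s • u) - y := by abel
      rw [← h1, h2]
      exact (norm_sub_le _ _).trans (by gcongr; exact hR _ hs)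
  have hI := eq_Icc_of_connected_compact ⟨h, hconv.isPreconnected⟩ hcomp
  refine ⟨_, _, ?_, hI⟩
  rw [hI] at h
  exact Set.nonempty_Icc.mp h

theorem inner_sub_inner_smul_self {n : ℕ} {u : Euc n} (hu : ‖u‖ = 1) (z : Euc n) :
    ⟪u, z - ⟪u, z⟫ • u⟫ = 0 := by
  rw [inner_sub_right, inner_smul_right, real_inner_self_eq_norm_sq, hu]
  ring

theorem inner_add_smul_of_orthogonal {n : ℕ} {u y : Euc n} (hu : ‖u‖ = 1) (hy : ⟪u, y⟫ = 0)
    (t : ℝ) : ⟪u, y + t • u⟫ = t := by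
  rw [inner_add_right, inner_smul_right, real_inner_self_eq_norm_sq, hu, hy]
  ring

theorem norm_sq_add_smul_of_orthogonal {n : ℕ} {u y : Euc n} (hu : ‖u‖ = 1) (hy : ⟪u, y⟫ = 0)
    (t : ℝ) : ‖y + t • u‖ ^ 2 = ‖y‖ ^ 2 + t ^ 2 := by
  rw [norm_add_sq_real, inner_smul_right, real_inner_comm, hy, norm_smul, hu]
  simp

theorem mem_steinerSymmetral_iff_chord {n : ℕ} {u : Euc n} (hu : ‖u‖ = 1) (K : Set (Euc n))
    {y : Euc n} (hy : ⟪u, y⟫ = 0) (t : ℝ) :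
    y + t • u ∈ steinerSymmetral u K ↔
      (chord u y K).Nonempty ∧ |t| ≤ (volume (chord u y K)).toReal / 2 := by
  constructor
  · rintro ⟨y', t', hy', hz, hne, ht⟩
    rw [Submodule.mem_orthogonal_singleton_iff_inner_right] at hy'
    have h1 := congrArg (fun w => ⟪u, w⟫) hz
    simp only [inner_add_smul_of_orthogonal hu hy, inner_add_smul_of_orthogonal hu hy'] at h1
    subst h1
    have : y = y' := add_right_cancel hz
    subst this
    exact ⟨hne, ht⟩
  · rintro ⟨hne, ht⟩
    exact ⟨y, t, Submodule.mem_orthogonal_singleton_iff_inner_right.mpr hy, rfl, hne, ht⟩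

theorem chord_steinerSymmetral_of_Icc {n : ℕ} {u : Euc n} (hu : ‖u‖ = 1) {K : Set (Euc n)}
    {y : Euc n} (hy : ⟪u, y⟫ = 0) {a b : ℝ} (hab : a ≤ b) (h : chord u y K = Set.Icc a b) :
    chord u y (steinerSymmetral u K) = Set.Icc (-((b - a) / 2)) ((b - a) / 2) := by
  ext t
  change y + t • u ∈ steinerSymmetral u K ↔ _
  rw [mem_steinerSymmetral_iff_chord hu K hy, h, Real.volume_Icc,
    ENNReal.toReal_ofReal (by linarith), Set.mem_Icc, ← abs_le]
  simp [hab]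

theorem chord_steinerSymmetral_of_empty {n : ℕ} {u : Euc n} (hu : ‖u‖ = 1) {K : Set (Euc n)}
    {y : Euc n} (hy : ⟪u, y⟫ = 0) (h : chord u y K = ∅) :
    chord u y (steinerSymmetral u K) = ∅ := by
  ext t
  change y + t • u ∈ steinerSymmetral u K ↔ _
  rw [mem_steinerSymmetral_iff_chord hu K hy, h]
  simp

theorem mem_steinerSymmetral_iff {n : ℕ} {u : Euc n} (hu : ‖u‖ = 1) {K : Set (Euc n)}
    (hK : IsCompact K) (hc : Convex ℝ K) (z : Euc n) :
    z ∈ steinerSymmetral u K ↔ ∃ a b : ℝ, z - ⟪u, z⟫ • u + a • u ∈ K ∧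
      z - ⟪u, z⟫ • u + b • u ∈ K ∧ |⟪u, z⟫| ≤ (b - a) / 2 := by
  have hy := inner_sub_inner_smul_self hu z
  set y := z - ⟪u, z⟫ • u with hydef
  set t := ⟪u, z⟫
  have hz : z = y + t • u := by rw [hydef]; abel
  rw [hz]
  change t ∈ chord u y (steinerSymmetral u K) ↔
    ∃ a b : ℝ, a ∈ chord u y K ∧ b ∈ chord u y K ∧ |t| ≤ (b - a) / 2
  rcases chord_eq_empty_or_Icc hu hK hc y with h | ⟨a, b, hab, h⟩
  · rw [chord_steinerSymmetral_of_empty hu hy h, h]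
    simp
  · rw [chord_steinerSymmetral_of_Icc hu hy hab h, h, Set.mem_Icc, ← abs_le]
    constructor
    · intro ht
      exact ⟨a, b, Set.left_mem_Icc.mpr hab, Set.right_mem_Icc.mpr hab, ht⟩
    · rintro ⟨c, d, hc, hd, ht⟩
      linarith [hc.1, hd.2]

theorem steinerSymmetral_subset_closedBall {n : ℕ} {u : Euc n} (hu : ‖u‖ = 1) {K : Set (Euc n)}
    (hK : IsCompact K) (hc : Convex ℝ K) {R : ℝ} (h : K ⊆ closedBall 0 R) :
    steinerSymmetral u K ⊆ closedBall 0 R := by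
  intro z hz
  rw [mem_steinerSymmetral_iff hu hK hc] at hz
  obtain ⟨a, b, ha, hb, ht⟩ := hz
  have ha' := mem_closedBall_zero_iff.mp (h ha)
  have hb' := mem_closedBall_zero_iff.mp (h hb)
  have hy := inner_sub_inner_smul_self hu z
  set y := z - ⟪u, z⟫ • u with hydef
  set t := ⟪u, z⟫
  have hz : z = y + t • u := by rw [hydef]; abel
  have hR : 0 ≤ R := (norm_nonneg _).trans ha'
  rw [mem_closedBall_zero_iff, hz]
  have h1 := pow_le_pow_left₀ (norm_nonneg _) ha' 2
  have h2 := pow_le_pow_left₀ (norm_nonneg _) hb' 2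
  rw [norm_sq_add_smul_of_orthogonal hu hy] at h1 h2
  refine le_of_sq_le_sq ?_ hR
  rw [norm_sq_add_smul_of_orthogonal hu hy]
  have h3 : t ^ 2 ≤ ((b - a) / 2) ^ 2 := by
    rw [← sq_abs]
    exact pow_le_pow_left₀ (abs_nonneg _) ht 2
  nlinarith [sq_nonneg (a + b)]

theorem steinerSymmetral_eq_image {n : ℕ} {u : Euc n} (hu : ‖u‖ = 1) {K : Set (Euc n)}
    (hK : IsCompact K) (hc : Convex ℝ K) :
    steinerSymmetral u K = (fun x : Euc n × Euc n × ℝ => x.1 - ⟪u, x.1⟫ • u + x.2.2 • u) ''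
      {x | x.1 ∈ K ∧ x.2.1 ∈ K ∧ x.1 - ⟪u, x.1⟫ • u = x.2.1 - ⟪u, x.2.1⟫ • u ∧
        |x.2.2| ≤ (⟪u, x.1⟫ - ⟪u, x.2.1⟫) / 2} := by
  ext z
  rw [mem_steinerSymmetral_iff hu hK hc]
  constructor
  · rintro ⟨a, b, ha, hb, ht⟩
    have hy := inner_sub_inner_smul_self hu z
    refine ⟨(z - ⟪u, z⟫ • u + b • u, z - ⟪u, z⟫ • u + a • u, ⟪u, z⟫), ⟨hb, ha, ?_, ?_⟩, ?_⟩
    · simp only [inner_add_smul_of_orthogonal hu hy]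
      abel
    · simpa only [inner_add_smul_of_orthogonal hu hy] using ht
    · simp only [inner_add_smul_of_orthogonal hu hy]
      abel
  · rintro ⟨⟨p, q, w⟩, ⟨hp, hq, hpq, hw⟩, rfl⟩
    dsimp only at *
    have hy := inner_sub_inner_smul_self hu p
    rw [inner_add_smul_of_orthogonal hu hy, add_sub_cancel_right]
    refine ⟨⟪u, q⟫, ⟪u, p⟫, ?_, ?_, hw⟩
    · rwa [hpq, sub_add_cancel]
    · rwa [sub_add_cancel]

theorem isCompact_steinerSymmetral {n : ℕ} {u : Euc n} (hu : ‖u‖ = 1) {K : Set (Euc n)}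
    (hK : IsCompact K) (hc : Convex ℝ K) : IsCompact (steinerSymmetral u K) := by
  rw [steinerSymmetral_eq_image hu hK hc]
  refine IsCompact.image ?_ (by fun_prop)
  obtain ⟨R, hR⟩ := hK.isBounded.exists_norm_le
  refine (hK.prod (hK.prod (isCompact_Icc (a := -R) (b := R)))).of_isClosed_subset ?_ ?_
  · refine IsClosed.inter (hK.isClosed.preimage continuous_fst)
      (IsClosed.inter (hK.isClosed.preimage (by fun_prop)) (IsClosed.inter ?_ ?_))
    · exact isClosed_eq
        (by fun_prop : Continuous fun x : Euc n × Euc n × ℝ => x.1 - ⟪u, x.1⟫ • u)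
        (by fun_prop : Continuous fun x : Euc n × Euc n × ℝ => x.2.1 - ⟪u, x.2.1⟫ • u)
    · exact isClosed_le
        (by fun_prop : Continuous fun x : Euc n × Euc n × ℝ => |x.2.2|)
        (by fun_prop : Continuous fun x : Euc n × Euc n × ℝ => (⟪u, x.1⟫ - ⟪u, x.2.1⟫) / 2)
  · rintro ⟨p, q, w⟩ ⟨hp, hq, -, hw⟩
    refine ⟨hp, hq, abs_le.mp (hw.trans ?_)⟩
    have h1 : |⟪u, p⟫| ≤ R :=
      (abs_real_inner_le_norm u p).trans ((by rw [hu, one_mul] : ‖u‖ * ‖p‖ = ‖p‖).trans_le (hR p hp))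
    have h2 : |⟪u, q⟫| ≤ R :=
      (abs_real_inner_le_norm u q).trans ((by rw [hu, one_mul] : ‖u‖ * ‖q‖ = ‖q‖).trans_le (hR q hq))
    linarith [(abs_le.mp h1).2, (abs_le.mp h2).1]

theorem convex_steinerSymmetral {n : ℕ} {u : Euc n} (hu : ‖u‖ = 1) {K : Set (Euc n)}
    (hK : IsCompact K) (hc : Convex ℝ K) : Convex ℝ (steinerSymmetral u K) := by
  intro z hz w hw s t hs ht hst
  rw [mem_steinerSymmetral_iff hu hK hc] at hz hw ⊢
  obtain ⟨a, b, ha, hb, hab⟩ := hz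
  obtain ⟨c, d, hc', hd, hcd⟩ := hw
  refine ⟨s * a + t * c, s * b + t * d, ?_, ?_, ?_⟩
  · convert hc ha hc' hs ht hst using 1
    simp only [inner_add_right, inner_smul_right]
    module
  · convert hc hb hd hs ht hst using 1
    simp only [inner_add_right, inner_smul_right]
    module
  · rw [inner_add_right, inner_smul_right, inner_smul_right]
    refine (abs_add_le _ _).trans ?_
    rw [abs_mul, abs_mul, abs_of_nonneg hs, abs_of_nonneg ht]
    nlinarith

/-- Steiner symmetrization commutes with reflections orthogonal to its direction. -/
theorem steinerSymmetral_reflection_invariant {n : ℕ} {u v : Euc n} (hu : ‖u‖ = 1)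
    (huv : ⟪u, v⟫ = 0) {K : Set (Euc n)} (hK : IsCompact K) (hc : Convex ℝ K)
    (h : ∀ x ∈ K, x - (2 * ⟪v, x⟫) • v ∈ K) :
    ∀ x ∈ steinerSymmetral u K, x - (2 * ⟪v, x⟫) • v ∈ steinerSymmetral u K := by
  intro x hx
  rw [mem_steinerSymmetral_iff hu hK hc] at hx ⊢
  obtain ⟨a, b, ha, hb, hab⟩ := hx
  have hvu : ⟪v, u⟫ = 0 := by rw [real_inner_comm]; exact huv
  have h1 : ⟪u, x - (2 * ⟪v, x⟫) • v⟫ = ⟪u, x⟫ := by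
    rw [inner_sub_right, inner_smul_right, huv]; ring
  rw [h1]
  refine ⟨a, b, ?_, ?_, hab⟩
  · convert h _ ha using 1
    simp only [inner_add_right, inner_sub_right, inner_smul_right, hvu]
    module
  · convert h _ hb using 1
    simp only [inner_add_right, inner_sub_right, inner_smul_right, hvu]
    module

theorem steinerSymmetral_reflection_self {n : ℕ} {u : Euc n} (hu : ‖u‖ = 1)
    {K : Set (Euc n)} (hK : IsCompact K) (hc : Convex ℝ K) :
    ∀ x ∈ steinerSymmetral u K, x - (2 * ⟪u, x⟫) • u ∈ steinerSymmetral u K := by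
  intro x hx
  rw [mem_steinerSymmetral_iff hu hK hc] at hx ⊢
  obtain ⟨a, b, ha, hb, hab⟩ := hx
  have h1 : ⟪u, x - (2 * ⟪u, x⟫) • u⟫ = - ⟪u, x⟫ := by
    rw [inner_sub_right, inner_smul_right, real_inner_self_eq_norm_sq, hu]; ring
  rw [h1, abs_neg]
  refine ⟨a, b, ?_, ?_, hab⟩
  · convert ha using 1
    module
  · convert hb using 1
    module

theorem steinerSymmetral_neg_mem {n : ℕ} {u : Euc n} (hu : ‖u‖ = 1)
    {K : Set (Euc n)} (hK : IsCompact K) (hc : Convex ℝ K) (h : ∀ x ∈ K, -x ∈ K) :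
    ∀ x ∈ steinerSymmetral u K, -x ∈ steinerSymmetral u K := by
  intro x hx
  rw [mem_steinerSymmetral_iff hu hK hc] at hx ⊢
  obtain ⟨a, b, ha, hb, hab⟩ := hx
  rw [inner_neg_right, abs_neg]
  refine ⟨-b, -a, ?_, ?_, by linarith⟩
  · convert h _ hb using 1
    module
  · convert h _ ha using 1
    module

/-- Parametrization of space by a hyperplane and its unit normal. -/
theorem measurePreserving_orthogonal_add_smul {n : ℕ} {u : Euc n} (hu : ‖u‖ = 1) :
    MeasurePreserving (fun p : ((ℝ ∙ u)ᗮ : Submodule ℝ (Euc n)) × ℝ => (p.1 : Euc n) + p.2 • u)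
      (volume.prod volume) volume := by
  have h1 : MeasurePreserving (LinearIsometryEquiv.toSpanUnitSingleton (𝕜 := ℝ) u hu)
    volume volume := LinearIsometryEquiv.measurePreserving _
  have h2 := (Submodule.orthogonalDecomposition (ℝ ∙ u)).symm.measurePreserving
  have h3 := WithLp.volume_preserving_toLp (ℝ ∙ u) ((ℝ ∙ u)ᗮ : Submodule ℝ (Euc n))
  have h4 := h2.comp (h3.comp ((h1.prod (MeasurePreserving.id
    (volume : Measure ((ℝ ∙ u)ᗮ : Submodule ℝ (Euc n))))).comp
      (Measure.measurePreserving_swap (μ := volume) (ν := volume))))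
  have h5 : (fun p : ((ℝ ∙ u)ᗮ : Submodule ℝ (Euc n)) × ℝ => (p.1 : Euc n) + p.2 • u) =
      (Submodule.orthogonalDecomposition (ℝ ∙ u)).symm ∘ WithLp.toLp 2 ∘
        Prod.map (LinearIsometryEquiv.toSpanUnitSingleton (𝕜 := ℝ) u hu) id ∘ Prod.swap := by
    funext p
    simp [add_comm]
  rw [h5]
  exact h4

theorem lintegral_eq_lintegral_orthogonal {n : ℕ} {u : Euc n} (hu : ‖u‖ = 1) {f : Euc n → ℝ≥0∞}
    (hf : Measurable f) :
    ∫⁻ x, f x = ∫⁻ y : ((ℝ ∙ u)ᗮ : Submodule ℝ (Euc n)), ∫⁻ t : ℝ, f ((y : Euc n) + t • u) := by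
  rw [← (measurePreserving_orthogonal_add_smul hu).lintegral_comp hf, lintegral_prod]
  exact (hf.comp (measurePreserving_orthogonal_add_smul hu).measurable).aemeasurable

theorem setLIntegral_eq_lintegral_chord {n : ℕ} {u : Euc n} (hu : ‖u‖ = 1) {K : Set (Euc n)}
    (hK : MeasurableSet K) {f : Euc n → ℝ≥0∞} (hf : Measurable f) :
    ∫⁻ x in K, f x = ∫⁻ y : ((ℝ ∙ u)ᗮ : Submodule ℝ (Euc n)),
      ∫⁻ t in chord u y K, f ((y : Euc n) + t • u) := by
  rw [← lintegral_indicator hK, lintegral_eq_lintegral_orthogonal hu (hf.indicator hK)]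
  refine lintegral_congr fun y => ?_
  have hm : MeasurableSet (chord u y K) :=
    (by fun_prop : Measurable fun s : ℝ => (y : Euc n) + s • u) hK
  rw [← lintegral_indicator hm]
  rfl

theorem inner_coe_orthogonal {n : ℕ} {u : Euc n} (y : ((ℝ ∙ u)ᗮ : Submodule ℝ (Euc n))) :
    ⟪u, (y : Euc n)⟫ = 0 :=
  Submodule.mem_orthogonal_singleton_iff_inner_right.mp y.2

/-- Integrals of functions constant along the direction of symmetrization are preserved. -/
theorem setLIntegral_steinerSymmetral_of_const {n : ℕ} {u : Euc n} (hu : ‖u‖ = 1)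
    {K : Set (Euc n)} (hK : IsCompact K) (hc : Convex ℝ K) {f : Euc n → ℝ≥0∞}
    (hf : Measurable f) (h : ∀ x (t : ℝ), f (x + t • u) = f x) :
    ∫⁻ x in steinerSymmetral u K, f x = ∫⁻ x in K, f x := by
  rw [setLIntegral_eq_lintegral_chord hu hK.measurableSet hf,
    setLIntegral_eq_lintegral_chord hu (isCompact_steinerSymmetral hu hK hc).measurableSet hf]
  refine lintegral_congr fun y => ?_
  simp only [h, setLIntegral_const]
  congr 1
  rcases chord_eq_empty_or_Icc hu hK hc y with h | ⟨a, b, hab, h⟩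
  · rw [chord_steinerSymmetral_of_empty hu (inner_coe_orthogonal y) h, h]
  · rw [chord_steinerSymmetral_of_Icc hu (inner_coe_orthogonal y) hab h, h]
    simp

theorem volume_steinerSymmetral {n : ℕ} {u : Euc n} (hu : ‖u‖ = 1)
    {K : Set (Euc n)} (hK : IsCompact K) (hc : Convex ℝ K) :
    volume (steinerSymmetral u K) = volume K := by
  simpa using setLIntegral_steinerSymmetral_of_const hu hK hc (f := fun _ => 1)
    measurable_const fun _ _ => rfl

/-- The moment of inertia of `K` about the origin. -/
noncomputable def secondMoment {n : ℕ} (K : Set (Euc n)) : ℝ≥0∞ :=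
  ∫⁻ x in K, ENNReal.ofReal (‖x‖ ^ 2)

/-- The second moment of `K` in direction `u`. -/
noncomputable def dirMoment {n : ℕ} (u : Euc n) (K : Set (Euc n)) : ℝ≥0∞ :=
  ∫⁻ x in K, ENNReal.ofReal (⟪u, x⟫ ^ 2)

theorem secondMoment_eq_add {n : ℕ} {u : Euc n} (hu : ‖u‖ = 1) (K : Set (Euc n)) :
    secondMoment K = (∫⁻ x in K, ENNReal.ofReal (‖x - ⟪u, x⟫ • u‖ ^ 2)) + dirMoment u K := by
  unfold secondMoment dirMoment
  rw [← lintegral_add_left (by fun_prop)]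
  refine lintegral_congr fun x => ?_
  rw [← ENNReal.ofReal_add (by positivity) (by positivity),
    ← norm_sq_add_smul_of_orthogonal hu (inner_sub_inner_smul_self hu x), sub_add_cancel]

theorem secondMoment_steinerSymmetral_add {n : ℕ} {u : Euc n} (hu : ‖u‖ = 1)
    {K : Set (Euc n)} (hK : IsCompact K) (hc : Convex ℝ K) :
    secondMoment (steinerSymmetral u K) + dirMoment u K =
      secondMoment K + dirMoment u (steinerSymmetral u K) := by
  rw [secondMoment_eq_add hu, secondMoment_eq_add hu K,
    setLIntegral_steinerSymmetral_of_const hu hK hc (by fun_prop), add_right_comm]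
  intro x t
  rw [inner_add_right, inner_smul_right, real_inner_self_eq_norm_sq, hu]
  congr 3
  module

theorem lintegral_Icc_ofReal_sq {a b : ℝ} (hab : a ≤ b) :
    ∫⁻ t in Set.Icc a b, ENNReal.ofReal (t ^ 2) = ENNReal.ofReal ((b ^ 3 - a ^ 3) / 3) := by
  rw [← ofReal_integral_eq_lintegral_ofReal
    ((by fun_prop : Continuous fun t : ℝ => t ^ 2).integrableOn_Icc)
    (Filter.Eventually.of_forall fun t => by positivity),
    integral_Icc_eq_integral_Ioc, ← intervalIntegral.integral_of_le hab, integral_pow]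
  norm_num

theorem dirMoment_eq_lintegral_chord {n : ℕ} {u : Euc n} (hu : ‖u‖ = 1) {K : Set (Euc n)}
    (hK : MeasurableSet K) :
    dirMoment u K = ∫⁻ y : ((ℝ ∙ u)ᗮ : Submodule ℝ (Euc n)),
      ∫⁻ t in chord u y K, ENNReal.ofReal (t ^ 2) := by
  unfold dirMoment
  rw [setLIntegral_eq_lintegral_chord hu hK (by fun_prop)]
  simp only [inner_add_smul_of_orthogonal hu (inner_coe_orthogonal _)]

/-- Quantitative decrease of the directional moment when chords through `B` are off-centre. -/
theorem dirMoment_steinerSymmetral_add_le {n : ℕ} {u : Euc n} (hu : ‖u‖ = 1)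
    {K : Set (Euc n)} (hK : IsCompact K) (hc : Convex ℝ K) {B : Set (Euc n)}
    (hB : MeasurableSet B) (hBK : B ⊆ K) {c : ℝ} (hc0 : 0 < c)
    (h : ∀ x ∈ B, ∀ τ : ℝ, x + τ • u ∈ K → c ≤ |2 * ⟪u, x⟫ + τ|) :
    dirMoment u (steinerSymmetral u K) + ENNReal.ofReal (c ^ 2 / 4) * volume B ≤
      dirMoment u K := by
  have hS := (isCompact_steinerSymmetral hu hK hc).measurableSet
  have hv : ENNReal.ofReal (c ^ 2 / 4) * volume B = ∫⁻ y : ((ℝ ∙ u)ᗮ : Submodule ℝ (Euc n)),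
      ENNReal.ofReal (c ^ 2 / 4) * volume (chord u y B) := by
    rw [← setLIntegral_const, setLIntegral_eq_lintegral_chord hu hB measurable_const]
    simp
  rw [hv, dirMoment_eq_lintegral_chord hu hS, dirMoment_eq_lintegral_chord hu hK.measurableSet]
  refine (le_lintegral_add _ _).trans (lintegral_mono fun y => ?_)
  have hy := inner_coe_orthogonal y
  have hsub : chord u y B ⊆ chord u y K := fun t ht => hBK ht
  rcases chord_eq_empty_or_Icc hu hK hc y with h0 | ⟨a, b, hab, h0⟩
  · rw [chord_steinerSymmetral_of_empty hu hy h0, h0]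
    rw [h0, Set.subset_empty_iff] at hsub
    simp [hsub]
  rw [chord_steinerSymmetral_of_Icc hu hy hab h0, h0, lintegral_Icc_ofReal_sq hab,
    lintegral_Icc_ofReal_sq (by linarith)]
  rcases Set.eq_empty_or_nonempty (chord u y B) with hE | ⟨t₀, ht₀⟩
  · rw [hE, measure_empty, mul_zero, add_zero]
    apply ENNReal.ofReal_le_ofReal
    nlinarith [mul_nonneg (sub_nonneg.mpr hab) (sq_nonneg (a + b))]
  have ht : t₀ ∈ Set.Icc a b := h0 ▸ hsub ht₀
  have key : ∀ s ∈ Set.Icc a b, c ≤ |s + t₀| := by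
    intro s hs
    rw [← h0] at hs
    have := h _ ht₀ (s - t₀) (by
      have h5 : (y : Euc n) + s • u ∈ K := hs
      convert h5 using 1
      module)
    rw [inner_add_smul_of_orthogonal hu hy] at this
    convert this using 2
    ring
  have hab2 : c ≤ |a + b| := by
    have ha := key a (Set.left_mem_Icc.mpr hab)
    have hb := key b (Set.right_mem_Icc.mpr hab)
    rcases le_abs.mp ha with ha | ha
    · exact le_abs.mpr (Or.inl (by linarith [ht.2]))
    · rcases le_abs.mp hb with hb | hb
      · have := key (-t₀) ⟨by linarith, by linarith⟩
        rw [neg_add_cancel, abs_zero] at this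
        linarith
      · exact le_abs.mpr (Or.inr (by linarith [ht.1]))
  have hvol : volume (chord u y B) ≤ ENNReal.ofReal (b - a) := by
    rw [← Real.volume_Icc, ← h0]
    exact measure_mono hsub
  have hsq : c ^ 2 ≤ (a + b) ^ 2 := by
    rw [← sq_abs (a + b)]
    exact pow_le_pow_left₀ hc0.le hab2 2
  refine (add_le_add_right (mul_le_mul_right hvol _) _).trans ?_
  have h3 : 0 ≤ b - a := sub_nonneg.mpr hab
  rw [← ENNReal.ofReal_mul (by positivity), ← ENNReal.ofReal_add _ (by positivity)]
  · apply ENNReal.ofReal_le_ofReal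
    nlinarith [mul_le_mul_of_nonneg_left hsq h3]
  · have : 0 ≤ ((b - a) / 2) ^ 3 := by positivity
    nlinarith

theorem dirMoment_steinerSymmetral_le {n : ℕ} {u : Euc n} (hu : ‖u‖ = 1)
    {K : Set (Euc n)} (hK : IsCompact K) (hc : Convex ℝ K) :
    dirMoment u (steinerSymmetral u K) ≤ dirMoment u K := by
  simpa using dirMoment_steinerSymmetral_add_le hu hK hc MeasurableSet.empty
    (Set.empty_subset K) one_pos (by simp)

/-- The moment of the symmetral in its own direction, as an integral over pairs of points of
`K` on a common line. -/
theorem two_mul_dirMoment_steinerSymmetral {n : ℕ} {u : Euc n} (hu : ‖u‖ = 1)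
    {K : Set (Euc n)} (hK : IsCompact K) (hc : Convex ℝ K) :
    2 * dirMoment u (steinerSymmetral u K) = ∫⁻ x in K, ∫⁻ r in Set.Ioi (0 : ℝ),
      K.indicator 1 (x + r • u) * ENNReal.ofReal r := by
  have hm : Measurable (K.indicator (1 : Euc n → ℝ≥0∞)) :=
    measurable_one.indicator hK.measurableSet
  rw [setLIntegral_eq_lintegral_chord hu hK.measurableSet (by fun_prop),
    dirMoment_eq_lintegral_chord hu (isCompact_steinerSymmetral hu hK hc).measurableSet,
    ← lintegral_const_mul' _ _ (by simp)]
  refine lintegral_congr fun y => ?_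
  have hy := inner_coe_orthogonal y
  rcases chord_eq_empty_or_Icc hu hK hc y with h0 | ⟨a, b, hab, h0⟩
  · rw [chord_steinerSymmetral_of_empty hu hy h0, h0]
    simp
  rw [chord_steinerSymmetral_of_Icc hu hy hab h0, h0,
    lintegral_Icc_ofReal_sq (by linarith)]
  have h1 : ∀ t ∈ Set.Icc a b, ∫⁻ r in Set.Ioi (0 : ℝ),
      K.indicator 1 ((y : Euc n) + t • u + r • u) * ENNReal.ofReal r =
      ENNReal.ofReal ((b - t) ^ 2 / 2) := by
    intro t ht
    have h2 : ∀ r ∈ Set.Ioi (0 : ℝ), K.indicator 1 ((y : Euc n) + t • u + r • u) *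
        ENNReal.ofReal r = (Set.Ioc 0 (b - t)).indicator (fun r => ENNReal.ofReal r) r := by
      intro r hr
      have h3 : (y : Euc n) + t • u + r • u ∈ K ↔ r ∈ Set.Ioc 0 (b - t) := by
        rw [add_assoc, ← add_smul]
        change t + r ∈ chord u y K ↔ _
        rw [h0]
        simp only [Set.mem_Icc, Set.mem_Ioc, Set.mem_Ioi] at hr ht ⊢
        constructor
        · rintro ⟨-, h⟩; exact ⟨hr, by linarith⟩
        · rintro ⟨-, h⟩; exact ⟨by linarith, by linarith⟩
      by_cases h4 : r ∈ Set.Ioc 0 (b - t)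
      · rw [Set.indicator_of_mem h4, Set.indicator_of_mem (h3.mpr h4), Pi.one_apply, one_mul]
      · rw [Set.indicator_of_notMem h4, Set.indicator_of_notMem (mt h3.mp h4), zero_mul]
    rw [setLIntegral_congr_fun measurableSet_Ioi h2, setLIntegral_indicator measurableSet_Ioc,
      Set.inter_eq_left.mpr fun r hr => hr.1,
      ← ofReal_integral_eq_lintegral_ofReal, ← intervalIntegral.integral_of_le (by linarith [ht.2]),
      integral_id]
    · simp
    · exact (continuous_id.integrableOn_Icc).mono_set Set.Ioc_subset_Icc_self
    · exact (ae_restrict_iff' measurableSet_Ioc).mpr (Filter.Eventually.of_forall fun r hr => hr.1.le)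
  rw [setLIntegral_congr_fun measurableSet_Icc h1, ← ofReal_integral_eq_lintegral_ofReal
      ((by fun_prop : Continuous fun t : ℝ => (b - t) ^ 2 / 2).integrableOn_Icc)
      (Filter.Eventually.of_forall fun t => by positivity),
    integral_Icc_eq_integral_Ioc, ← intervalIntegral.integral_of_le hab,
    intervalIntegral.integral_div, intervalIntegral.integral_comp_sub_left (fun t => t ^ 2) b,
    integral_pow, ← ENNReal.ofReal_ofNat 2, ← ENNReal.ofReal_mul (by norm_num)]
  congr 1
  norm_num
  ring

theorem setLIntegral_Icc_comp_sub_left {κ : ℝ → ℝ≥0∞} (p r α : ℝ) :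
    ∫⁻ s in Set.Icc (r - α) (r + α), κ (p - s) =
      ∫⁻ s in Set.Icc (p - r - α) (p - r + α), κ s := by
  rw [← (Measure.measurePreserving_sub_left volume p).setLIntegral_comp_preimage_emb
    (MeasurableEquiv.subLeft p).measurableEmbedding]
  simp only [sub_sub_cancel]
  congr 2
  ext s
  simp only [Set.mem_Icc, Set.mem_preimage]
  constructor <;> rintro ⟨h1, h2⟩ <;> constructor <;> linarith

theorem setLIntegral_window_le_of_nonneg {κ : ℝ → ℝ≥0∞} (hκ : ∀ s t, |s| ≤ |t| → κ t ≤ κ s)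
    {α r r' : ℝ} (hα : 0 ≤ α) (hr : 0 ≤ r) (hrr : r ≤ r') :
    ∫⁻ s in Set.Icc (r' - α) (r' + α), κ s ≤ ∫⁻ s in Set.Icc (r - α) (r + α), κ s := by
  set B := Set.Icc (r - α) (r + α) with hB
  set B' := Set.Icc (r' - α) (r' + α) with hB'
  rw [← lintegral_inter_add_sdiff κ B' (measurableSet_Icc : MeasurableSet B),
    ← lintegral_inter_add_sdiff κ B (measurableSet_Icc : MeasurableSet B'), Set.inter_comm]
  refine add_le_add_right ?_ _
  rw [← (Measure.measurePreserving_sub_left volume (r + r')).setLIntegral_comp_preimage_emb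
    (MeasurableEquiv.subLeft (r + r')).measurableEmbedding κ (B \ B')]
  have hpre : (fun s => r + r' - s) ⁻¹' (B \ B') = B' \ B := by
    ext s
    simp only [Set.mem_preimage, Set.mem_sdiff, hB, hB', Set.mem_Icc]
    constructor <;> rintro ⟨⟨h1, h2⟩, h3⟩ <;> refine ⟨⟨by linarith, by linarith⟩, fun h => h3 ?_⟩ <;>
      exact ⟨by linarith [h.2], by linarith [h.1]⟩
  rw [hpre]
  refine setLIntegral_mono' (measurableSet_Icc.diff measurableSet_Icc) fun s hs => hκ _ _ ?_
  obtain ⟨⟨h1, h2⟩, h3⟩ := hs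
  have h4 : r + α < s := by
    by_contra! h
    exact h3 ⟨by linarith, h⟩
  rw [abs_of_nonneg (by linarith : 0 ≤ s), abs_le]
  constructor <;> linarith

theorem setLIntegral_window_le {κ : ℝ → ℝ≥0∞} (hκ : ∀ s t, |s| ≤ |t| → κ t ≤ κ s)
    {α r r' : ℝ} (hα : 0 ≤ α) (hrr : |r| ≤ |r'|) :
    ∫⁻ s in Set.Icc (r' - α) (r' + α), κ s ≤ ∫⁻ s in Set.Icc (r - α) (r + α), κ s := by
  have heven : ∀ r : ℝ, ∫⁻ s in Set.Icc (r - α) (r + α), κ s =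
      ∫⁻ s in Set.Icc (|r| - α) (|r| + α), κ s := by
    intro r
    rcases abs_choice r with h | h
    · rw [h]
    · rw [h, ← zero_sub, ← setLIntegral_Icc_comp_sub_left]
      refine lintegral_congr fun s => le_antisymm (hκ _ _ ?_) (hκ _ _ ?_) <;> simp
  rw [heven r, heven r']
  exact setLIntegral_window_le_of_nonneg hκ hα (abs_nonneg r) hrr

/-- Riesz rearrangement for a pair of intervals. -/
theorem lintegral_interval_interval_le {κ : ℝ → ℝ≥0∞} (hκ : ∀ s t, |s| ≤ |t| → κ t ≤ κ s)
    {a b c d : ℝ} (hab : a ≤ b) (hcd : c ≤ d) :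
    ∫⁻ s in Set.Icc a b, ∫⁻ t in Set.Icc c d, κ (s - t) ≤
      ∫⁻ s in Set.Icc (-((b - a) / 2)) ((b - a) / 2),
        ∫⁻ t in Set.Icc (-((d - c) / 2)) ((d - c) / 2), κ (s - t) := by
  have hIcc : ∀ a b : ℝ, Set.Icc a b =
      Set.Icc ((a + b) / 2 - (b - a) / 2) ((a + b) / 2 + (b - a) / 2) := by
    intro a b
    congr 1 <;> ring
  have hIcc0 : ∀ α : ℝ, Set.Icc (-α) α = Set.Icc (0 - α) (0 + α) := by simp
  rw [hIcc a b, hIcc c d, hIcc0, hIcc0]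
  set α := (b - a) / 2
  set β := (d - c) / 2
  set m := (a + b) / 2
  set m' := (c + d) / 2
  have hα : 0 ≤ α := by simp only [α]; linarith
  have hβ : 0 ≤ β := by simp only [β]; linarith
  simp only [setLIntegral_Icc_comp_sub_left]
  set H : ℝ → ℝ≥0∞ := fun r => ∫⁻ s in Set.Icc (r - β) (r + β), κ s with hHdef
  have hH : ∀ s t, |s| ≤ |t| → H t ≤ H s := fun s t h => setLIntegral_window_le hκ hβ h
  have hHe : ∀ s t, H (s - t) = H (t - s) := fun s t =>
    le_antisymm (hH _ _ (by rw [abs_sub_comm])) (hH _ _ (by rw [abs_sub_comm]))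
  change ∫⁻ s in Set.Icc (m - α) (m + α), H (s - m') ≤
    ∫⁻ s in Set.Icc (0 - α) (0 + α), H (s - 0)
  simp only [hHe _ m', hHe _ 0]
  rw [setLIntegral_Icc_comp_sub_left, setLIntegral_Icc_comp_sub_left]
  exact setLIntegral_window_le hH hα (by simp)

/-- The Riesz energy kernel. -/
noncomputable def rieszKernel {n : ℕ} (w : Euc n) : ℝ≥0∞ := (ENNReal.ofReal ‖w‖ ^ (n - 2))⁻¹

@[fun_prop]
theorem measurable_rieszKernel {n : ℕ} : Measurable (rieszKernel (n := n)) := by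
  unfold rieszKernel
  fun_prop

theorem rieszKernel_anti {n : ℕ} {v w : Euc n} (h : ‖v‖ ≤ ‖w‖) :
    rieszKernel w ≤ rieszKernel v := by
  unfold rieszKernel
  gcongr

/-- The Riesz energy of `K`. -/
noncomputable def rieszEnergy {n : ℕ} (K : Set (Euc n)) : ℝ≥0∞ :=
  ∫⁻ x in K, ∫⁻ z in K, rieszKernel (x - z)

theorem rieszEnergy_eq_lintegral_chord {n : ℕ} {u : Euc n} (hu : ‖u‖ = 1) {K : Set (Euc n)}
    (hK : MeasurableSet K) :
    rieszEnergy K = ∫⁻ y : ((ℝ ∙ u)ᗮ : Submodule ℝ (Euc n)),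
      ∫⁻ y' : ((ℝ ∙ u)ᗮ : Submodule ℝ (Euc n)), ∫⁻ t in chord u y K, ∫⁻ t' in chord u y' K,
        rieszKernel ((y : Euc n) + t • u - ((y' : Euc n) + t' • u)) := by
  unfold rieszEnergy
  rw [setLIntegral_eq_lintegral_chord hu hK
    (Measurable.lintegral_prod_right' (f := fun p : Euc n × Euc n => rieszKernel (p.1 - p.2))
      (by fun_prop))]
  refine lintegral_congr fun y => ?_
  have h1 : ∀ x : Euc n, ∫⁻ z in K, rieszKernel (x - z) =
      ∫⁻ y' : ((ℝ ∙ u)ᗮ : Submodule ℝ (Euc n)), ∫⁻ t' in chord u y' K,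
        rieszKernel (x - ((y' : Euc n) + t' • u)) := fun x =>
    setLIntegral_eq_lintegral_chord hu hK (by fun_prop)
  simp only [h1]
  refine lintegral_lintegral_swap ?_
  have h2 : ∀ (x : Euc n) (y' : ((ℝ ∙ u)ᗮ : Submodule ℝ (Euc n))),
      ∫⁻ t' in chord u y' K, rieszKernel (x - ((y' : Euc n) + t' • u)) =
      ∫⁻ t' : ℝ, K.indicator 1 ((y' : Euc n) + t' • u) * rieszKernel (x - ((y' : Euc n) + t' • u)) := by
    intro x y'
    have hm : MeasurableSet (chord u y' K) :=
      (by fun_prop : Measurable fun s : ℝ => (y' : Euc n) + s • u) hK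
    rw [← lintegral_indicator hm]
    refine lintegral_congr fun t' => ?_
    by_cases h : (y' : Euc n) + t' • u ∈ K
    · rw [Set.indicator_of_mem h, Set.indicator_of_mem (s := chord u y' K) h, Pi.one_apply, one_mul]
    · rw [Set.indicator_of_notMem h, Set.indicator_of_notMem (s := chord u y' K) h, zero_mul]
  simp only [h2]
  have hm : Measurable (K.indicator (1 : Euc n → ℝ≥0∞)) := measurable_one.indicator hK
  refine (Measurable.lintegral_prod_right'
    (f := fun p : (ℝ × ((ℝ ∙ u)ᗮ : Submodule ℝ (Euc n))) × ℝ =>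
      K.indicator 1 ((p.1.2 : Euc n) + p.2 • u) *
        rieszKernel ((y : Euc n) + p.1.1 • u - ((p.1.2 : Euc n) + p.2 • u))) ?_).aemeasurable
  fun_prop

theorem rieszEnergy_le_steinerSymmetral {n : ℕ} {u : Euc n} (hu : ‖u‖ = 1) {K : Set (Euc n)}
    (hK : IsCompact K) (hc : Convex ℝ K) :
    rieszEnergy K ≤ rieszEnergy (steinerSymmetral u K) := by
  rw [rieszEnergy_eq_lintegral_chord hu hK.measurableSet, rieszEnergy_eq_lintegral_chord hu
    (isCompact_steinerSymmetral hu hK hc).measurableSet]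
  refine lintegral_mono fun y => lintegral_mono fun y' => ?_
  have hy := inner_coe_orthogonal y
  have hy' := inner_coe_orthogonal y'
  rcases chord_eq_empty_or_Icc hu hK hc y with h | ⟨a, b, hab, h⟩
  · rw [h]; simp
  rcases chord_eq_empty_or_Icc hu hK hc y' with h' | ⟨c, d, hcd, h'⟩
  · rw [h']; simp
  dsimp only
  rw [chord_steinerSymmetral_of_Icc hu hy hab h, chord_steinerSymmetral_of_Icc hu hy' hcd h', h, h']
  have hk : ∀ t t' : ℝ, (y : Euc n) + t • u - ((y' : Euc n) + t' • u) =
      ((y : Euc n) - (y' : Euc n)) + (t - t') • u := by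
    intro t t'
    module
  simp only [hk]
  refine lintegral_interval_interval_le
    (κ := fun s => rieszKernel ((y : Euc n) - (y' : Euc n) + s • u)) (fun s t hst => ?_) hab hcd
  refine rieszKernel_anti (le_of_sq_le_sq ?_ (norm_nonneg _))
  have hyy : ⟪u, (y : Euc n) - (y' : Euc n)⟫ = 0 := by rw [inner_sub_right, hy, hy', sub_zero]
  rw [norm_sq_add_smul_of_orthogonal hu hyy, norm_sq_add_smul_of_orthogonal hu hyy]
  linarith [sq_le_sq.mpr hst]

theorem lintegral_comp_smul_of_pos {E : Type*} [NormedAddCommGroup E] [NormedSpace ℝ E]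
    [FiniteDimensional ℝ E] [MeasurableSpace E] [BorelSpace E] (μ : Measure E)
    [μ.IsAddHaarMeasure] {f : E → ℝ≥0∞} {s : ℝ} (hs : 0 < s) :
    ∫⁻ v, f (s • v) ∂μ = ENNReal.ofReal ((s ^ Module.finrank ℝ E)⁻¹) * ∫⁻ w, f w ∂μ := by
  have hemb : MeasurableEmbedding (fun v : E => s • v) :=
    (Homeomorph.smulOfNeZero s hs.ne').measurableEmbedding
  rw [← hemb.lintegral_map, Measure.map_addHaar_smul μ hs.ne', lintegral_smul_measure,
    abs_of_pos (by positivity), smul_eq_mul]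

/-- The integral of `‖v‖ ^ 2` over the unit ball. -/
noncomputable def ballMoment (n : ℕ) : ℝ≥0∞ := secondMoment (closedBall (0 : Euc n) 1)

theorem ballMoment_ne_zero {n : ℕ} (hn : 0 < n) : ballMoment n ≠ 0 := by
  have : Nonempty (Fin n) := ⟨⟨0, hn⟩⟩
  have : Nontrivial (Euc n) := inferInstance
  unfold ballMoment secondMoment
  rw [← pos_iff_ne_zero, setLIntegral_pos_iff (by fun_prop)]
  have h1 : (0 : ℝ≥0∞) < volume (ball (0 : Euc n) 1 \ {0}) := by
    rw [measure_sdiff_null (by simp)]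
    exact measure_ball_pos _ _ one_pos
  refine h1.trans_le (measure_mono ?_)
  rintro x ⟨hx, hx0⟩
  refine ⟨?_, ball_subset_closedBall hx⟩
  rw [Function.mem_support, ne_eq, ENNReal.ofReal_eq_zero, not_le]
  have : 0 < ‖x‖ := norm_pos_iff.mpr hx0
  positivity

theorem secondMoment_le {n : ℕ} {K : Set (Euc n)} {R : ℝ} (h : K ⊆ closedBall 0 R) :
    secondMoment K ≤ ENNReal.ofReal (R ^ 2) * volume K := by
  unfold secondMoment
  rw [← setLIntegral_const]
  refine setLIntegral_mono measurable_const fun x hx => ?_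
  gcongr
  exact mem_closedBall_zero_iff.mp (h hx)

theorem ballMoment_ne_top (n : ℕ) : ballMoment n ≠ ∞ :=
  ne_top_of_le_ne_top (ENNReal.mul_ne_top (by simp) measure_closedBall_lt_top.ne)
    (secondMoment_le subset_rfl)

theorem dirMoment_closedBall_congr {n : ℕ} {x y : Euc n} (h : ‖x‖ = ‖y‖) (r : ℝ) :
    dirMoment x (closedBall 0 r) = dirMoment y (closedBall 0 r) := by
  unfold dirMoment
  set ρ := (ℝ ∙ (x - y))ᗮ.reflection
  have hρ : ρ x = y := Submodule.reflection_sub h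
  rw [← ρ.measurePreserving.setLIntegral_comp_preimage_emb
    ρ.toHomeomorph.measurableEmbedding (fun v => ENNReal.ofReal (⟪y, v⟫ ^ 2))]
  rw [LinearIsometryEquiv.preimage_closedBall, map_zero]
  refine lintegral_congr fun v => ?_
  rw [← hρ, LinearIsometryEquiv.inner_map_map]

theorem nat_mul_dirMoment_closedBall {n : ℕ} (x : Euc n) :
    n * dirMoment x (closedBall 0 1) = ballMoment n * ENNReal.ofReal (‖x‖ ^ 2) := by
  have h1 : ∀ i : Fin n, dirMoment x (closedBall 0 1) =
      dirMoment (EuclideanSpace.single i ‖x‖) (closedBall (0 : Euc n) 1) := fun i =>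
    dirMoment_closedBall_congr (by simp) 1
  have h2 : ∑ i : Fin n, dirMoment x (closedBall (0 : Euc n) 1) =
      ∑ i : Fin n, dirMoment (EuclideanSpace.single i ‖x‖) (closedBall (0 : Euc n) 1) :=
    Finset.sum_congr rfl fun i _ => h1 i
  rw [Finset.sum_const, Finset.card_univ, Fintype.card_fin, nsmul_eq_mul] at h2
  rw [h2]
  unfold dirMoment ballMoment secondMoment
  rw [← lintegral_finsetSum _ (by fun_prop), ← lintegral_mul_const _ (by fun_prop)]
  refine lintegral_congr fun v => ?_
  rw [← ENNReal.ofReal_sum_of_nonneg (fun i _ => by positivity),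
    ← ENNReal.ofReal_mul (by positivity), EuclideanSpace.real_norm_sq_eq v, Finset.sum_mul]
  congr 1
  refine Finset.sum_congr rfl fun i _ => ?_
  rw [EuclideanSpace.inner_single_left]
  simp
  ring

theorem nat_mul_lintegral_dirMoment {n : ℕ} (K : Set (Euc n)) :
    n * ∫⁻ v in closedBall (0 : Euc n) 1, dirMoment v K = ballMoment n * secondMoment K := by
  unfold dirMoment secondMoment
  rw [lintegral_lintegral_swap (by fun_prop), ← lintegral_const_mul' _ _ (by simp),
    ← lintegral_const_mul _ (by fun_prop)]
  refine lintegral_congr fun x => ?_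
  rw [← nat_mul_dirMoment_closedBall]
  unfold dirMoment
  simp only [real_inner_comm]

theorem dirMoment_smul {n : ℕ} (c : ℝ) (u : Euc n) (K : Set (Euc n)) :
    dirMoment (c • u) K = ENNReal.ofReal (c ^ 2) * dirMoment u K := by
  unfold dirMoment
  rw [← lintegral_const_mul _ (by fun_prop)]
  refine lintegral_congr fun x => ?_
  rw [← ENNReal.ofReal_mul (by positivity), real_inner_smul_left, mul_pow]

/-- The homogeneous extension of the directional moment of the symmetral. -/
noncomputable def symmetralMoment {n : ℕ} (K : Set (Euc n)) (v : Euc n) : ℝ≥0∞ :=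
  ENNReal.ofReal (‖v‖ ^ 4) * ∫⁻ x in K, ∫⁻ s in Set.Ioi (0 : ℝ),
    K.indicator 1 (x + s • v) * ENNReal.ofReal s

theorem symmetralMoment_smul {n : ℕ} {u : Euc n} (hu : ‖u‖ = 1) {c : ℝ} (h0 : 0 < c)
    {K : Set (Euc n)} (hK : IsCompact K) (hc : Convex ℝ K) :
    symmetralMoment K (c • u) = 2 * (ENNReal.ofReal (c ^ 2) *
      dirMoment u (steinerSymmetral u K)) := by
  have hm : Measurable (K.indicator (1 : Euc n → ℝ≥0∞)) :=
    measurable_one.indicator hK.measurableSet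
  rw [mul_left_comm, two_mul_dirMoment_steinerSymmetral hu hK hc]
  unfold symmetralMoment
  rw [← lintegral_const_mul _ (by fun_prop), ← lintegral_const_mul _ (by fun_prop)]
  refine lintegral_congr fun x => ?_
  have h1 := lintegral_comp_smul_of_pos (volume : Measure ℝ) (f := (Set.Ioi (0 : ℝ)).indicator
    fun r => K.indicator 1 (x + r • u) * ENNReal.ofReal r) h0
  rw [lintegral_indicator measurableSet_Ioi] at h1
  have h2 : ∫⁻ s in Set.Ioi (0 : ℝ), K.indicator 1 (x + s • c • u) * ENNReal.ofReal s =
      ENNReal.ofReal c⁻¹ * ∫⁻ v : ℝ, (Set.Ioi (0 : ℝ)).indicator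
        (fun r => K.indicator 1 (x + r • u) * ENNReal.ofReal r) (c • v) := by
    rw [← lintegral_indicator measurableSet_Ioi, ← lintegral_const_mul' _ _ (by simp)]
    refine lintegral_congr fun s => ?_
    have hiff : c • s ∈ Set.Ioi (0 : ℝ) ↔ s ∈ Set.Ioi (0 : ℝ) := by
      simp [mul_pos_iff_of_pos_left h0]
    by_cases hs : s ∈ Set.Ioi (0 : ℝ)
    · rw [Set.indicator_of_mem hs, Set.indicator_of_mem (hiff.mpr hs), smul_smul, smul_eq_mul,
        mul_left_comm, mul_comm s c, ← ENNReal.ofReal_mul (by positivity),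
        inv_mul_cancel_left₀ h0.ne']
    · rw [Set.indicator_of_notMem hs, Set.indicator_of_notMem (mt hiff.mp hs), mul_zero]
  rw [h2, h1, ← mul_assoc, ← mul_assoc, ← ENNReal.ofReal_mul (by positivity),
    ← ENNReal.ofReal_mul (by positivity), norm_smul, hu, Module.finrank_self]
  congr 2
  rw [Real.norm_of_nonneg h0.le]
  field_simp

theorem measurable_symmetralMoment {n : ℕ} {K : Set (Euc n)} (hK : MeasurableSet K) :
    Measurable (symmetralMoment K) := by
  have hm : Measurable (K.indicator (1 : Euc n → ℝ≥0∞)) := measurable_one.indicator hK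
  unfold symmetralMoment
  refine Measurable.mul (by fun_prop) ?_
  refine Measurable.lintegral_prod_right' (f := fun p : Euc n × Euc n =>
    ∫⁻ s in Set.Ioi (0 : ℝ), K.indicator 1 (p.2 + s • p.1) * ENNReal.ofReal s) ?_
  exact Measurable.lintegral_prod_right' (f := fun p : (Euc n × Euc n) × ℝ =>
    K.indicator 1 (p.1.2 + p.2 • p.1.1) * ENNReal.ofReal p.2) (by fun_prop)

theorem lintegral_Ioi_kernel {n : ℕ} (hn : 2 ≤ n) {ρ : ℝ} (hρ : 0 < ρ) :
    ∫⁻ s in Set.Ioi ρ, ENNReal.ofReal (ρ ^ 4 * s ^ (-(n + 3 : ℝ))) =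
      ENNReal.ofReal (1 / (n + 2)) * (ENNReal.ofReal ρ ^ (n - 2))⁻¹ := by
  have h1 : -(n + 3 : ℝ) < -1 := by linarith [(Nat.cast_nonneg n : (0 : ℝ) ≤ n)]
  rw [← ofReal_integral_eq_lintegral_ofReal ((integrableOn_Ioi_rpow_of_lt h1 hρ).const_mul _)]
  · rw [integral_const_mul, integral_Ioi_rpow_of_lt h1 hρ, ← ENNReal.ofReal_pow hρ.le,
      ← ENNReal.ofReal_inv_of_pos (by positivity), ← ENNReal.ofReal_mul (by positivity)]
    congr 1
    obtain ⟨m, rfl⟩ := Nat.exists_eq_add_of_le hn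
    have h2 : -(((2 + m : ℕ) : ℝ) + 3) + 1 = -((m + 4 : ℕ) : ℝ) := by push_cast; ring
    rw [h2, Real.rpow_neg hρ.le, Real.rpow_natCast, Nat.add_sub_cancel_left]
    push_cast
    have h3 : (2 + m + 2 : ℝ) ≠ 0 := by positivity
    have h4 : (m + 4 : ℝ) ≠ 0 := by positivity
    field_simp
    ring
  · refine (ae_restrict_iff' measurableSet_Ioi).mpr (Filter.Eventually.of_forall fun s hs => ?_)
    have : 0 < s := hρ.trans hs
    positivity

/-- The density at `w` of the dilate by `s` of the weight `‖v‖ ^ 4` on the unit ball, times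
`s`. -/
noncomputable def dilatedWeight (n : ℕ) (s : ℝ) (w : Euc n) : ℝ≥0∞ :=
  if ‖w‖ ≤ s then ENNReal.ofReal (‖w‖ ^ 4 * s ^ (-(n + 3 : ℝ))) else 0

theorem measurable_dilatedWeight {n : ℕ} :
    Measurable fun p : ℝ × Euc n => dilatedWeight n p.1 p.2 :=
  Measurable.ite (measurableSet_le (by fun_prop) (by fun_prop)) (by fun_prop) measurable_const

theorem lintegral_dilatedWeight {n : ℕ} (hn : 2 ≤ n) {w : Euc n} (hw : w ≠ 0) :
    ∫⁻ s in Set.Ioi (0 : ℝ), dilatedWeight n s w =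
      ENNReal.ofReal (1 / (n + 2)) * rieszKernel w := by
  have hw' : 0 < ‖w‖ := norm_pos_iff.mpr hw
  unfold rieszKernel
  rw [← lintegral_Ioi_kernel hn hw', ← lintegral_indicator measurableSet_Ioi,
    ← setLIntegral_congr (Ioi_ae_eq_Ici (a := ‖w‖)).symm,
    ← lintegral_indicator measurableSet_Ici]
  refine lintegral_congr fun s => ?_
  unfold dilatedWeight
  simp only [Set.indicator_apply, Set.mem_Ioi, Set.mem_Ici]
  by_cases h : ‖w‖ ≤ s
  · rw [if_pos (hw'.trans_le h), if_pos h]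
  · simp [h]

theorem lintegral_dilatedWeight_mul {n : ℕ} {s : ℝ} (hs : 0 < s) (f : Euc n → ℝ≥0∞) :
    ∫⁻ v in closedBall (0 : Euc n) 1,
      ENNReal.ofReal (‖v‖ ^ 4) * (f (s • v) * ENNReal.ofReal s) =
      ∫⁻ w, dilatedWeight n s w * f w := by
  have h2 := lintegral_comp_smul_of_pos (volume : Measure (Euc n))
    (f := fun w => dilatedWeight n s w * f w) hs
  rw [finrank_euclideanSpace_fin] at h2
  have h3 : ∫⁻ w, dilatedWeight n s w * f w =
      ENNReal.ofReal (s ^ n) * ∫⁻ v, dilatedWeight n s (s • v) * f (s • v) := by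
    rw [h2, ← mul_assoc, ← ENNReal.ofReal_mul (by positivity),
      mul_inv_cancel₀ (by positivity)]
    simp
  rw [h3, ← lintegral_const_mul' _ _ (by simp), ← lintegral_indicator
    measurableSet_closedBall]
  refine lintegral_congr fun v => ?_
  unfold dilatedWeight
  rw [norm_smul, Real.norm_of_nonneg hs.le]
  have h4 : s * ‖v‖ ≤ s ↔ ‖v‖ ≤ 1 := mul_le_iff_le_one_right hs
  by_cases hv : ‖v‖ ≤ 1
  · rw [Set.indicator_of_mem (mem_closedBall_zero_iff.mpr hv), if_pos (h4.mpr hv),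
      mul_comm (f _), ← mul_assoc, ← mul_assoc,
      ← ENNReal.ofReal_mul (by positivity), ← ENNReal.ofReal_mul (by positivity)]
    congr 2
    have h4 : (n + 3 : ℝ) = ((n + 3 : ℕ) : ℝ) := by push_cast; ring
    rw [h4, Real.rpow_neg hs.le, Real.rpow_natCast]
    field_simp
    ring
  · rw [Set.indicator_of_notMem (mt mem_closedBall_zero_iff.mp hv), if_neg (mt h4.mp hv),
      zero_mul, mul_zero]

theorem lintegral_dilatedWeight_swap {n : ℕ} {f : Euc n → ℝ≥0∞} (hf : Measurable f) :
    ∫⁻ s in Set.Ioi (0 : ℝ), ∫⁻ w, dilatedWeight n s w * f w =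
      ∫⁻ w, (∫⁻ s in Set.Ioi (0 : ℝ), dilatedWeight n s w) * f w := by
  have hG := measurable_dilatedWeight (n := n)
  have h1 : Measurable fun p : ℝ × Euc n => dilatedWeight n p.1 p.2 * f p.2 :=
    hG.mul (hf.comp measurable_snd)
  have h3 : ∀ w, Measurable fun s : ℝ => dilatedWeight n s w := fun w =>
    Measurable.of_uncurry_right (f := dilatedWeight n) hG
  have h4 : ∀ w, ∫⁻ s in Set.Ioi (0 : ℝ), dilatedWeight n s w * f w =
    (∫⁻ s in Set.Ioi (0 : ℝ), dilatedWeight n s w) * f w := fun w =>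
    lintegral_mul_const (f w) (h3 w)
  simp only [← h4]
  exact lintegral_lintegral_swap h1.aemeasurable

theorem lintegral_symmetralMoment {n : ℕ} (hn : 2 ≤ n) {K : Set (Euc n)}
    (hK : MeasurableSet K) :
    ∫⁻ v in closedBall (0 : Euc n) 1, symmetralMoment K v =
      ENNReal.ofReal (1 / (n + 2)) * rieszEnergy K := by
  have hm : Measurable (K.indicator (1 : Euc n → ℝ≥0∞)) := measurable_one.indicator hK
  have hG := measurable_dilatedWeight (n := n)
  calc ∫⁻ v in closedBall (0 : Euc n) 1, symmetralMoment K v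
      = ∫⁻ v in closedBall (0 : Euc n) 1, ∫⁻ x in K, ∫⁻ s in Set.Ioi (0 : ℝ),
          ENNReal.ofReal (‖v‖ ^ 4) * (K.indicator 1 (x + s • v) * ENNReal.ofReal s) := by
        refine lintegral_congr fun v => ?_
        unfold symmetralMoment
        rw [← lintegral_const_mul' _ _ (by simp)]
        refine lintegral_congr fun x => ?_
        rw [← lintegral_const_mul' _ _ (by simp)]
    _ = ∫⁻ x in K, ∫⁻ s in Set.Ioi (0 : ℝ), ∫⁻ v in closedBall (0 : Euc n) 1,
          ENNReal.ofReal (‖v‖ ^ 4) * (K.indicator 1 (x + s • v) * ENNReal.ofReal s) := by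
        rw [lintegral_lintegral_swap]
        · refine lintegral_congr fun x => ?_
          rw [lintegral_lintegral_swap]
          exact Measurable.aemeasurable (by unfold Function.uncurry; fun_prop)
        · refine (Measurable.lintegral_prod_right' (f := fun p : (Euc n × Euc n) × ℝ =>
            ENNReal.ofReal (‖p.1.1‖ ^ 4) * (K.indicator 1 (p.1.2 + p.2 • p.1.1) *
              ENNReal.ofReal p.2)) (by fun_prop)).aemeasurable
    _ = ∫⁻ x in K, ∫⁻ s in Set.Ioi (0 : ℝ), ∫⁻ w,
          dilatedWeight n s w * K.indicator 1 (x + w) :=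
        lintegral_congr fun x => setLIntegral_congr_fun measurableSet_Ioi fun s hs =>
          lintegral_dilatedWeight_mul hs fun w => K.indicator 1 (x + w)
    _ = ∫⁻ x in K, ∫⁻ w, (∫⁻ s in Set.Ioi (0 : ℝ), dilatedWeight n s w) *
          K.indicator 1 (x + w) := by
        refine lintegral_congr fun x => ?_
        exact lintegral_dilatedWeight_swap (f := fun w => K.indicator 1 (x + w)) (by fun_prop)
    _ = ∫⁻ x in K, ENNReal.ofReal (1 / (n + 2)) * ∫⁻ z in K, rieszKernel (x - z) := by
        refine lintegral_congr fun x => ?_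
        rw [← lintegral_const_mul _ (by fun_prop), ← lintegral_indicator hK,
          ← lintegral_add_left_eq_self (K.indicator _) x]
        have hne : ∀ᵐ w : Euc n, w ≠ 0 := by
          have : Nonempty (Fin n) := ⟨⟨0, by omega⟩⟩
          have : Nontrivial (Euc n) := inferInstance
          exact Measure.ae_ne volume 0
        refine lintegral_congr_ae (hne.mono fun w hw => ?_)
        dsimp only
        rw [lintegral_dilatedWeight hn hw]
        by_cases hx : x + w ∈ K
        · rw [Set.indicator_of_mem hx, Set.indicator_of_mem hx, Pi.one_apply, mul_one]
          unfold rieszKernel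
          rw [sub_add_cancel_left, norm_neg]
        · rw [Set.indicator_of_notMem hx, Set.indicator_of_notMem hx, mul_zero]
    _ = ENNReal.ofReal (1 / (n + 2)) * rieszEnergy K := by
        unfold rieszEnergy
        rw [lintegral_const_mul' _ _ (by simp)]

/-- If no single symmetrization decreases the moment of inertia of `K` by more than `δ`, then
the moment of inertia of any body of larger Riesz energy is at least that of `K` minus `n * δ`. -/
theorem secondMoment_le_of_forall_dirMoment_le {n : ℕ} (hn : 2 ≤ n) {K K' : Set (Euc n)}
    (hK : IsCompact K) (hc : Convex ℝ K) (hK' : IsCompact K') (hc' : Convex ℝ K')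
    (hJ : rieszEnergy K ≤ rieszEnergy K') {δ : ℝ≥0∞}
    (h : ∀ u : Euc n, ‖u‖ = 1 → dirMoment u K ≤ dirMoment u (steinerSymmetral u K) + δ) :
    secondMoment K ≤ secondMoment K' + n * δ := by
  have hdec : ∀ v : Euc n, v = 0 ∨ ∃ (u : Euc n) (c : ℝ), ‖u‖ = 1 ∧ 0 < c ∧ c = ‖v‖ ∧
      v = c • u := by
    intro v
    by_cases hv : v = 0
    · exact Or.inl hv
    have hv' : 0 < ‖v‖ := norm_pos_iff.mpr hv
    refine Or.inr ⟨‖v‖⁻¹ • v, ‖v‖, ?_, hv', rfl, ?_⟩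
    · rw [norm_smul, norm_inv, norm_norm, inv_mul_cancel₀ hv'.ne']
    · rw [smul_smul, mul_inv_cancel₀ hv'.ne', one_smul]
  have hlow : ∀ v : Euc n, 2 * dirMoment v K ≤
      symmetralMoment K v + ENNReal.ofReal (‖v‖ ^ 2) * (2 * δ) := by
    intro v
    rcases hdec v with rfl | ⟨u, c, hu, h0, hcv, rfl⟩
    · simp [dirMoment]
    · rw [← hcv, symmetralMoment_smul hu h0 hK hc, dirMoment_smul, mul_left_comm _ 2 δ, ← mul_add,
        ← mul_add]
      gcongr
      exact h u hu
  have hup : ∀ v : Euc n, symmetralMoment K' v ≤ 2 * dirMoment v K' := by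
    intro v
    rcases hdec v with rfl | ⟨u, c, hu, h0, hcv, rfl⟩
    · simp [symmetralMoment]
    · rw [symmetralMoment_smul hu h0 hK' hc', dirMoment_smul]
      gcongr
      exact dirMoment_steinerSymmetral_le hu hK' hc'
  have hB : ∫⁻ v in closedBall (0 : Euc n) 1, ENNReal.ofReal (‖v‖ ^ 2) * (2 * δ) =
      ballMoment n * (2 * δ) := by
    rw [lintegral_mul_const _ (by fun_prop)]
    rfl
  have h1 : 2 * (ballMoment n * secondMoment K) ≤
      n * ((∫⁻ v in closedBall (0 : Euc n) 1, symmetralMoment K v) + ballMoment n * (2 * δ)) := by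
    rw [← nat_mul_lintegral_dirMoment, mul_left_comm, ← lintegral_const_mul' 2 _ (by simp), ← hB,
      ← lintegral_add_left (measurable_symmetralMoment hK.measurableSet)]
    exact mul_le_mul_right (lintegral_mono hlow) _
  have h2 : n * (∫⁻ v in closedBall (0 : Euc n) 1, symmetralMoment K' v) ≤
      2 * (ballMoment n * secondMoment K') := by
    rw [← nat_mul_lintegral_dirMoment, mul_left_comm, ← lintegral_const_mul' 2 _ (by simp)]
    exact mul_le_mul_right (lintegral_mono hup) _
  have h3 : (∫⁻ v in closedBall (0 : Euc n) 1, symmetralMoment K v) ≤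
      ∫⁻ v in closedBall (0 : Euc n) 1, symmetralMoment K' v := by
    rw [lintegral_symmetralMoment hn hK.measurableSet,
      lintegral_symmetralMoment hn hK'.measurableSet]
    gcongr
  have h4 : (2 * ballMoment n) * secondMoment K ≤
      (2 * ballMoment n) * (secondMoment K' + n * δ) :=
    calc (2 * ballMoment n) * secondMoment K = 2 * (ballMoment n * secondMoment K) := by ring
      _ ≤ n * ((∫⁻ v in closedBall (0 : Euc n) 1, symmetralMoment K v) +
            ballMoment n * (2 * δ)) := h1
      _ ≤ n * ((∫⁻ v in closedBall (0 : Euc n) 1, symmetralMoment K' v) +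
            ballMoment n * (2 * δ)) := by gcongr
      _ = n * (∫⁻ v in closedBall (0 : Euc n) 1, symmetralMoment K' v) +
            (2 * ballMoment n) * (n * δ) := by ring
      _ ≤ 2 * (ballMoment n * secondMoment K') + (2 * ballMoment n) * (n * δ) := by gcongr
      _ = (2 * ballMoment n) * (secondMoment K' + n * δ) := by ring
  exact (ENNReal.mul_le_mul_iff_right (mul_ne_zero two_ne_zero (ballMoment_ne_zero (by omega)))
    (ENNReal.mul_ne_top (by simp) (ballMoment_ne_top n))).mp h4

/-- `K'` arises from `K` by `N` successive Steiner symmetrizations. -/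
def IsIteratedSymmetral {n : ℕ} (N : ℕ) (K K' : Set (Euc n)) : Prop :=
  ∃ l : List (Euc n), l.length = N ∧ (∀ v ∈ l, ‖v‖ = 1) ∧
    l.foldl (fun S v => steinerSymmetral v S) K = K'

theorem IsIteratedSymmetral.refl {n : ℕ} (K : Set (Euc n)) : IsIteratedSymmetral 0 K K :=
  ⟨[], rfl, by simp, rfl⟩

theorem IsIteratedSymmetral.trans {n : ℕ} {N M : ℕ} {K K' K'' : Set (Euc n)}
    (h : IsIteratedSymmetral N K K') (h' : IsIteratedSymmetral M K' K'') :
    IsIteratedSymmetral (N + M) K K'' := by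
  obtain ⟨l, rfl, hl, rfl⟩ := h
  obtain ⟨l', rfl, hl', rfl⟩ := h'
  refine ⟨l ++ l', by simp, fun v hv => ?_, by simp⟩
  rcases List.mem_append.mp hv with h | h
  exacts [hl v h, hl' v h]

theorem IsIteratedSymmetral.single {n : ℕ} {u : Euc n} (hu : ‖u‖ = 1) (K : Set (Euc n)) :
    IsIteratedSymmetral 1 K (steinerSymmetral u K) :=
  ⟨[u], rfl, by simpa using hu, rfl⟩

theorem IsIteratedSymmetral.preserves {n : ℕ} {P : Set (Euc n) → Prop}
    (hP : ∀ u : Euc n, ‖u‖ = 1 → ∀ K, IsCompact K → Convex ℝ K → P K → P (steinerSymmetral u K))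
    {N : ℕ} {K K' : Set (Euc n)} (h : IsIteratedSymmetral N K K') (hK : IsCompact K)
    (hc : Convex ℝ K) (hPK : P K) : IsCompact K' ∧ Convex ℝ K' ∧ P K' := by
  obtain ⟨l, -, hl, rfl⟩ := h
  induction l generalizing K with
  | nil => exact ⟨hK, hc, hPK⟩
  | cons u l ih =>
    have hu := hl u (by simp)
    exact ih (isCompact_steinerSymmetral hu hK hc) (convex_steinerSymmetral hu hK hc)
      (hP u hu K hK hc hPK) fun v hv => hl v (by simp [hv])

theorem IsIteratedSymmetral.isCompact_convex_volume {n N : ℕ} {K K' : Set (Euc n)}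
    (h : IsIteratedSymmetral N K K') (hK : IsCompact K) (hc : Convex ℝ K) :
    IsCompact K' ∧ Convex ℝ K' ∧ volume K' = volume K :=
  h.preserves (P := fun L => volume L = volume K)
    (fun _ hu _ hL hcL h => (volume_steinerSymmetral hu hL hcL).trans h) hK hc rfl

/-- The box with half side lengths `a` in the frame `b`. -/
def frameBox {n : ℕ} (b : Fin n → Euc n) (a : Fin n → ℝ) : Set (Euc n) :=
  {x | ∀ i, |⟪b i, x⟫| ≤ a i}

theorem orthonormal_update_rotation {n : ℕ} {b : Fin n → Euc n} (hb : Orthonormal ℝ b)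
    {i j : Fin n} (hij : i ≠ j) {c s : ℝ} (hcs : c ^ 2 + s ^ 2 = 1) :
    Orthonormal ℝ (Function.update (Function.update b i (c • b i + s • b j)) j
      (-s • b i + c • b j)) := by
  have hself : ∀ k, ⟪b k, b k⟫ = 1 := fun k => by
    rw [real_inner_self_eq_norm_sq, hb.1 k, one_pow]
  have hne : ∀ k l, k ≠ l → ⟪b k, b l⟫ = 0 := fun k l h => hb.2 h
  have hji := hij.symm
  rw [orthonormal_iff_ite]
  intro k l
  rcases eq_or_ne k j with rfl | hkj
  · rcases eq_or_ne l k with rfl | hlj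
    · simp only [Function.update_self, inner_add_left, inner_add_right, real_inner_smul_left,
        real_inner_smul_right, hself, hne _ _ hij, hne _ _ hji, if_true]
      linarith
    · rw [if_neg hlj.symm, Function.update_self, Function.update_of_ne hlj]
      rcases eq_or_ne l i with rfl | hli
      · simp only [Function.update_self, inner_add_left, inner_add_right, real_inner_smul_left,
          real_inner_smul_right, hself, hne _ _ hij, hne _ _ hji]
        ring
      · simp only [Function.update_of_ne hli, inner_add_left, real_inner_smul_left,
          hne _ _ hli.symm, hne _ _ hlj.symm]
        ring
  · rw [Function.update_of_ne hkj]
    rcases eq_or_ne k i with rfl | hki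
    · rw [Function.update_self]
      rcases eq_or_ne l j with rfl | hlj
      · simp only [Function.update_self, inner_add_left, inner_add_right, real_inner_smul_left,
          real_inner_smul_right, hself, hne _ _ hij, hne _ _ hji, if_neg hkj]
        ring
      · rw [Function.update_of_ne hlj]
        rcases eq_or_ne l k with rfl | hli
        · simp only [Function.update_self, inner_add_left, inner_add_right, real_inner_smul_left,
            real_inner_smul_right, hself, hne _ _ hij, hne _ _ hji, if_true]
          linarith
        · simp only [Function.update_of_ne hli, inner_add_left, real_inner_smul_left,
            hne _ _ hli.symm, hne _ _ hlj.symm, if_neg hli.symm]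
          ring
    · rw [Function.update_of_ne hki]
      rcases eq_or_ne l j with rfl | hlj
      · simp only [Function.update_self, inner_add_right, real_inner_smul_right,
          hne _ _ hki, hne _ _ hkj, if_neg hkj]
        ring
      · rw [Function.update_of_ne hlj]
        rcases eq_or_ne l i with rfl | hli
        · simp only [Function.update_self, inner_add_right, real_inner_smul_right,
            hne _ _ hki, hne _ _ hkj, if_neg hki]
          ring
        · rw [Function.update_of_ne hli]
          exact orthonormal_iff_ite.mp hb k l

theorem exists_reflection_invariant_symmetral {n : ℕ} (b : OrthonormalBasis (Fin n) ℝ (Euc n))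
    {K : Set (Euc n)} (hK : IsCompact K) (hc : Convex ℝ K) (s : Finset (Fin n)) :
    ∃ K', IsIteratedSymmetral s.card K K' ∧
      ∀ i ∈ s, ∀ x ∈ K', x - (2 * ⟪b i, x⟫) • b i ∈ K' := by
  induction s using Finset.induction_on with
  | empty => exact ⟨K, .refl K, by simp⟩
  | insert j s hj ih =>
    obtain ⟨K', hK', hs⟩ := ih
    obtain ⟨hk, hcc, -⟩ := hK'.isCompact_convex_volume hK hc
    have hu : ‖b j‖ = 1 := b.orthonormal.1 j
    refine ⟨_, by simpa [Finset.card_insert_of_notMem hj] using hK'.trans (.single hu K'), ?_⟩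
    intro i hi
    rcases Finset.mem_insert.mp hi with rfl | hi
    · exact steinerSymmetral_reflection_self hu hk hcc
    · refine steinerSymmetral_reflection_invariant hu (b.orthonormal.2 ?_) hk hcc (hs i hi)
      rintro rfl
      exact hj hi

theorem sub_smul_sum_mem_of_reflection_invariant {n : ℕ} (b : OrthonormalBasis (Fin n) ℝ (Euc n))
    {K : Set (Euc n)} (hc : Convex ℝ K) (h : ∀ i, ∀ x ∈ K, x - (2 * ⟪b i, x⟫) • b i ∈ K)
    {c : ℝ} (hc0 : 0 ≤ c) (hc2 : c ≤ 2) {x : Euc n} (hx : x ∈ K) (s : Finset (Fin n)) :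
    x - c • ∑ i ∈ s, ⟪b i, x⟫ • b i ∈ K := by
  induction s using Finset.induction_on with
  | empty => simpa using hx
  | insert j s hj ih =>
    have hin : ⟪b j, x - c • ∑ i ∈ s, ⟪b i, x⟫ • b i⟫ = ⟪b j, x⟫ := by
      rw [inner_sub_right, real_inner_smul_right, inner_sum, Finset.sum_eq_zero, mul_zero, sub_zero]
      intro i hi
      rw [real_inner_smul_right, b.orthonormal.2 (by rintro rfl; exact hj hi), mul_zero]
    have := hc ih (h j _ ih) (a := 1 - c / 2) (b := c / 2) (by linarith) (by linarith) (by ring)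
    rw [hin] at this
    convert this using 1
    rw [Finset.sum_insert hj]
    module

theorem neg_mem_of_reflection_invariant {n : ℕ} (b : OrthonormalBasis (Fin n) ℝ (Euc n))
    {K : Set (Euc n)} (hc : Convex ℝ K) (h : ∀ i, ∀ x ∈ K, x - (2 * ⟪b i, x⟫) • b i ∈ K)
    {x : Euc n} (hx : x ∈ K) : -x ∈ K := by
  have := sub_smul_sum_mem_of_reflection_invariant b hc h zero_le_two le_rfl hx Finset.univ
  rw [b.sum_repr' x] at this
  convert this using 1
  module

theorem inner_smul_mem_of_reflection_invariant {n : ℕ} (b : OrthonormalBasis (Fin n) ℝ (Euc n))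
    {K : Set (Euc n)} (hc : Convex ℝ K) (h : ∀ i, ∀ x ∈ K, x - (2 * ⟪b i, x⟫) • b i ∈ K)
    {x : Euc n} (hx : x ∈ K) (i : Fin n) : ⟪b i, x⟫ • b i ∈ K := by
  have := sub_smul_sum_mem_of_reflection_invariant b hc h zero_le_one one_le_two hx
    (Finset.univ.erase i)
  convert this using 1
  rw [one_smul, eq_sub_iff_add_eq,
    Finset.add_sum_erase _ (fun i => ⟪b i, x⟫ • b i) (Finset.mem_univ i), b.sum_repr' x]

theorem volume_frameBox {n : ℕ} (b : OrthonormalBasis (Fin n) ℝ (Euc n)) (a : Fin n → ℝ) :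
    volume (frameBox b a) = ∏ i, ENNReal.ofReal (2 * a i) := by
  have hmp := (EuclideanSpace.volume_preserving_symm_measurableEquiv_toLp (Fin n)).comp
    b.measurePreserving_repr
  have : frameBox b a = (MeasurableEquiv.toLp 2 (Fin n → ℝ)).symm ∘ b.repr ⁻¹' Set.Icc (-a) a := by
    ext x
    simp [frameBox, abs_le, Pi.le_def, forall_and, b.repr_apply_apply]
  rw [this, hmp.measure_preimage measurableSet_Icc.nullMeasurableSet, Real.volume_Icc_pi]
  refine Finset.prod_congr rfl fun i _ => ?_
  rw [Pi.neg_apply]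
  ring_nf

theorem closedBall_subset_frameBox {n : ℕ} (b : OrthonormalBasis (Fin n) ℝ (Euc n)) :
    closedBall (0 : Euc n) 1 ⊆ frameBox b fun _ => 1 := fun x hx i => by
  have := abs_real_inner_le_norm (b i) x
  rw [b.orthonormal.1 i, one_mul] at this
  exact this.trans (mem_closedBall_zero_iff.mp hx)

theorem exists_subset_frameBox {n : ℕ} (b : OrthonormalBasis (Fin n) ℝ (Euc n)) (hn : 0 < n)
    {K : Set (Euc n)} (hK : IsCompact K) (hc : Convex ℝ K)
    (hvol : volume K = volume (closedBall (0 : Euc n) 1))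
    (h : ∀ i, ∀ x ∈ K, x - (2 * ⟪b i, x⟫) • b i ∈ K) :
    ∃ a : Fin n → ℝ, (∀ i, 0 < a i) ∧ K ⊆ frameBox b a ∧ ∏ i, a i ≤ (n : ℝ) ^ n := by
  have hn' : (0 : ℝ) < n := by exact_mod_cast hn
  have hpos : 0 < volume K := hvol ▸ measure_closedBall_pos _ _ one_pos
  have hne : K.Nonempty := nonempty_of_measure_ne_zero hpos.ne'
  have hmax : ∀ i, ∃ x ∈ K, ∀ y ∈ K, ⟪b i, y⟫ ≤ ⟪b i, x⟫ := fun i => by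
    obtain ⟨x, hx, hm⟩ := hK.exists_isMaxOn hne (f := fun y => ⟪b i, y⟫) (by fun_prop)
    exact ⟨x, hx, fun y hy => hm hy⟩
  choose p hpK hp using hmax
  have hsub : K ⊆ frameBox b fun i => ⟪b i, p i⟫ := fun x hx i => by
    refine abs_le'.mpr ⟨hp i x hx, ?_⟩
    simpa using hp i _ (neg_mem_of_reflection_invariant b hc h hx)
  have ha0 : ∀ i, 0 < ⟪b i, p i⟫ := fun i => by
    by_contra! hle
    have := hpos.trans_le (measure_mono hsub)
    rw [volume_frameBox, Finset.prod_eq_zero (Finset.mem_univ i)] at this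
    · exact lt_irrefl _ this
    · exact ENNReal.ofReal_of_nonpos (by linarith)
  refine ⟨_, ha0, hsub, ?_⟩
  have hseg : ∀ i, ∀ t : ℝ, |t| ≤ ⟪b i, p i⟫ → t • b i ∈ K := fun i t ht => by
    have h1 := inner_smul_mem_of_reflection_invariant b hc h (hpK i) i
    have h2 := neg_mem_of_reflection_invariant b hc h h1
    have h0 := ha0 i
    obtain ⟨hl, hr⟩ := abs_le.mp ht
    have := hc h1 h2 (a := (1 + t / ⟪b i, p i⟫) / 2) (b := (1 - t / ⟪b i, p i⟫) / 2)
      (by have : -1 ≤ t / ⟪b i, p i⟫ := by rw [le_div_iff₀ h0]; linarith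
          linarith)
      (by have : t / ⟪b i, p i⟫ ≤ 1 := by rw [div_le_iff₀ h0]; linarith
          linarith) (by ring)
    convert this using 1
    rw [← neg_smul, smul_smul, smul_smul, ← add_smul]
    congr 1
    field_simp
    ring
  have hbox : frameBox b (fun i => ⟪b i, p i⟫ / n) ⊆ K := fun y hy => by
    have : ∑ i, (n : ℝ)⁻¹ • ((n * ⟪b i, y⟫) • b i) ∈ K := by
      refine hc.sum_mem (fun _ _ => by positivity) ?_ fun i _ => hseg i _ ?_
      · simp [hn'.ne']
      · rw [abs_mul, abs_of_pos hn', mul_comm, ← le_div_iff₀ hn']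
        exact hy i
    convert this using 1
    rw [← b.sum_repr' y]
    refine Finset.sum_congr rfl fun i _ => ?_
    rw [b.sum_repr' y, smul_smul, inv_mul_cancel_left₀ hn'.ne']
  have hv := (measure_mono hbox).trans (hvol.le.trans (measure_mono (closedBall_subset_frameBox b)))
  rw [volume_frameBox, volume_frameBox, ← ENNReal.ofReal_prod_of_nonneg,
    ← ENNReal.ofReal_prod_of_nonneg, ENNReal.ofReal_le_ofReal_iff] at hv
  · simp only [mul_one, Finset.prod_const, Finset.card_univ, Fintype.card_fin,
      Finset.prod_mul_distrib, Finset.prod_div_distrib] at hv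
    have := le_of_mul_le_mul_left (hv.trans_eq (mul_one _).symm) (by positivity)
    rwa [div_le_one (by positivity)] at this
  · positivity
  · intros; positivity
  · intro i _
    have := ha0 i
    positivity

theorem steinerSymmetral_subset_frameBox {n : ℕ} {b : Fin n → Euc n} (hb : Orthonormal ℝ b)
    {i j : Fin n} (hij : i ≠ j) {a : Fin n → ℝ} {g : ℝ} (hj : 0 < a j) (hjg : a j ≤ g)
    (hgi : g ≤ a i) {K : Set (Euc n)} (hK : IsCompact K) (hc : Convex ℝ K)
    (h : K ⊆ frameBox b a) :
    ∃ (u : Euc n) (b' : Fin n → Euc n), ‖u‖ = 1 ∧ Orthonormal ℝ b' ∧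
      steinerSymmetral u K ⊆ frameBox b'
        (Function.update (Function.update a i g) j (2 * a i * a j / g)) := by
  have hg : 0 < g := hj.trans_le hjg
  have hs0 : 0 < a j / g := by positivity
  have hs1 : a j / g ≤ 1 := (div_le_one hg).mpr hjg
  set s := a j / g with hs
  set c := √(1 - s ^ 2) with hcdef
  have hcs : c ^ 2 + s ^ 2 = 1 := by
    rw [hcdef, Real.sq_sqrt (by nlinarith)]
    ring
  have hc0 : 0 ≤ c := Real.sqrt_nonneg _
  have hc1 : c ≤ 1 := by nlinarith
  have hb' := orthonormal_update_rotation hb hij hcs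
  have hji := hij.symm
  have hself : ∀ k, ⟪b k, b k⟫ = 1 := fun k => by
    rw [real_inner_self_eq_norm_sq, hb.1 k, one_pow]
  have hne : ∀ k l, k ≠ l → ⟪b k, b l⟫ = 0 := fun k l h => hb.2 h
  set u := c • b i + s • b j with hudef
  have hu : ‖u‖ = 1 := by simpa [Function.update_of_ne hij] using hb'.1 i
  refine ⟨u, _, hu, hb', fun x hx k => ?_⟩
  rw [mem_steinerSymmetral_iff hu hK hc] at hx
  obtain ⟨α, β, hα, hβ, hx⟩ := hx
  have key : ∀ v : Euc n, ⟪v, u⟫ = 0 → ⟪v, x⟫ = ⟪v, x - ⟪u, x⟫ • u + α • u⟫ := fun v hv => by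
    simp [inner_add_right, inner_sub_right, real_inner_smul_right, hv]
  have hjeq : ⟪b j, u⟫ = s := by
    simp [hudef, inner_add_right, real_inner_smul_right, hb.1 j, hne _ _ hji]
  rcases eq_or_ne k j with rfl | hkj
  · rw [Function.update_self, Function.update_self, key]
    · rw [inner_add_left, real_inner_smul_left, real_inner_smul_left]
      refine (abs_add_le _ _).trans ?_
      rw [abs_mul, abs_mul, abs_neg, abs_of_pos hs0, abs_of_nonneg hc0]
      have h1 := h hα i
      have h2 := h hα k
      have h3 : a k ≤ a i * a k / g := by rw [le_div_iff₀ hg]; nlinarith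
      have h4 : s * a i = a i * a k / g := by rw [hs]; ring
      calc _ ≤ s * a i + 1 * a k := by gcongr
        _ ≤ a i * a k / g + a i * a k / g := by rw [h4]; linarith
        _ = _ := by ring
    · simp only [hudef, inner_add_left, inner_add_right, real_inner_smul_left,
        real_inner_smul_right, hself, hne _ _ hij, hne _ _ hji]
      ring
  · rw [Function.update_of_ne hkj, Function.update_of_ne hkj]
    rcases eq_or_ne k i with rfl | hki
    · rw [Function.update_self, Function.update_self]
      refine hx.trans ?_
      have h1 := abs_le.mp (h hα j)
      have h2 := abs_le.mp (h hβ j)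
      rw [inner_add_right, real_inner_smul_right, hjeq] at h1 h2
      have h3 : (β - α) * s ≤ 2 * a j := by linarith [h1.1, h2.2]
      have h4 : g * s = a j := by rw [hs]; field_simp
      have : β - α ≤ 2 * g := le_of_mul_le_mul_right (by linarith) hs0
      linarith
    · rw [Function.update_of_ne hki, Function.update_of_ne hki, key]
      · exact h hα k
      · simp [hudef, inner_add_right, real_inner_smul_right, hne _ _ hki, hne _ _ hkj]

theorem exists_symmetral_subset_frameBox {n : ℕ} {G : ℝ} (hG : 0 < G) (U : Finset (Fin n))
    {b : Fin n → Euc n} (hb : Orthonormal ℝ b) {a : Fin n → ℝ} (ha : ∀ i, 0 < a i)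
    (haU : ∀ i ∉ U, a i ≤ G) (hprod : ∏ i ∈ U, a i ≤ (G / 2) ^ U.card)
    {K : Set (Euc n)} (hK : IsCompact K) (hc : Convex ℝ K) (h : K ⊆ frameBox b a) :
    ∃ (N : ℕ) (K' : Set (Euc n)) (b' : Fin n → Euc n), N ≤ U.card ∧ IsIteratedSymmetral N K K' ∧
      Orthonormal ℝ b' ∧ K' ⊆ frameBox b' fun _ => G := by
  induction hm : U.card generalizing U b a K with
  | zero =>
    rw [Finset.card_eq_zero] at hm
    subst hm
    exact ⟨0, K, b, le_rfl, .refl K, hb, fun x hx i => (h hx i).trans (haU i (by simp))⟩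
  | succ m ih =>
    by_cases hall : ∀ i, a i ≤ G
    · exact ⟨0, K, b, by simp, .refl K, hb, fun x hx i => (h hx i).trans (hall i)⟩
    push Not at hall
    obtain ⟨i, hi⟩ := hall
    have hiU : i ∈ U := by
      by_contra hiU
      exact (haU i hiU).not_gt hi
    obtain ⟨j, hjU, hj⟩ : ∃ j ∈ U, a j ≤ G / 2 := by
      by_contra! hlt
      have := Finset.prod_lt_prod_of_nonempty (s := U) (f := fun _ => G / 2) (g := a)
        (fun _ _ => by positivity) hlt ⟨i, hiU⟩
      rw [Finset.prod_const] at this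
      exact hprod.not_gt this
    have hij : i ≠ j := by
      rintro rfl
      linarith
    obtain ⟨u, b', hu, hb', hsub⟩ :=
      steinerSymmetral_subset_frameBox hb hij (ha j) (by linarith : a j ≤ G) hi.le hK hc h
    have hcard : (U.erase i).card = m := by rw [Finset.card_erase_of_mem hiU, hm, Nat.add_sub_cancel]
    have hjU' : j ∈ U.erase i := Finset.mem_erase.mpr ⟨hij.symm, hjU⟩
    set a' := Function.update (Function.update a i G) j (2 * a i * a j / G) with ha'
    have hpos : ∀ k, 0 < a' k := by
      intro k
      have := ha i
      have := ha j
      rcases eq_or_ne k j with rfl | hkj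
      · rw [ha', Function.update_self]; positivity
      rw [ha', Function.update_of_ne hkj]
      rcases eq_or_ne k i with rfl | hki
      · rwa [Function.update_self]
      · rw [Function.update_of_ne hki]; exact ha k
    have hout : ∀ k ∉ U.erase i, a' k ≤ G := by
      intro k hk
      have hkj : k ≠ j := by rintro rfl; exact hk hjU'
      rw [ha', Function.update_of_ne hkj]
      rcases eq_or_ne k i with rfl | hki
      · rw [Function.update_self]
      · rw [Function.update_of_ne hki]
        exact haU k fun hkU => hk (Finset.mem_erase.mpr ⟨hki, hkU⟩)
    have hprod' : ∏ k ∈ U.erase i, a' k ≤ (G / 2) ^ (U.erase i).card := by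
      rw [hcard, ← Finset.mul_prod_erase _ _ hjU', ha', Function.update_self]
      have : ∏ k ∈ (U.erase i).erase j, a' k =
          ∏ k ∈ (U.erase i).erase j, a k := by
        refine Finset.prod_congr rfl fun k hk => ?_
        rw [Finset.mem_erase, Finset.mem_erase] at hk
        rw [ha', Function.update_of_ne hk.1, Function.update_of_ne hk.2.1]
      rw [this]
      rw [hm, ← Finset.mul_prod_erase _ _ hiU, ← Finset.mul_prod_erase _ _ hjU', pow_succ] at hprod
      calc _ = (a i * (a j * ∏ k ∈ (U.erase i).erase j, a k)) * (2 / G) := by ring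
        _ ≤ ((G / 2) ^ m * (G / 2)) * (2 / G) := by gcongr
        _ = _ := by field_simp
    obtain ⟨N, K', b'', hN, hK', hb'', hsub'⟩ := ih (U.erase i) hb' hpos hout hprod'
      (isCompact_steinerSymmetral hu hK hc) (convex_steinerSymmetral hu hK hc) hsub hcard
    exact ⟨1 + N, K', b'', by omega, (IsIteratedSymmetral.single hu K).trans hK', hb'', hsub'⟩

theorem frameBox_subset_closedBall {n : ℕ} (hn : 0 < n) {b : Fin n → Euc n}
    (hb : Orthonormal ℝ b) {G : ℝ} (hG : 0 ≤ G) :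
    frameBox b (fun _ => G) ⊆ closedBall 0 (n * G) := fun x hx => by
  have : Nonempty (Fin n) := ⟨⟨0, hn⟩⟩
  let B := (basisOfOrthonormalOfCardEqFinrank hb (by simp)).toOrthonormalBasis (by simpa using hb)
  have hB : ∀ i, B i = b i := fun i => by simp [B]
  have hn1 : (1 : ℝ) ≤ n := by exact_mod_cast hn
  rw [mem_closedBall_zero_iff]
  refine abs_le_of_sq_le_sq' ?_ (by positivity) |>.2
  rw [← B.sum_sq_norm_inner_right x]
  calc _ ≤ ∑ _i : Fin n, G ^ 2 := Finset.sum_le_sum fun i _ => by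
        rw [hB, Real.norm_eq_abs]
        exact pow_le_pow_left₀ (abs_nonneg _) (hx i) 2
    _ = n * G ^ 2 := by simp
    _ ≤ _ := by nlinarith [sq_nonneg G, mul_nonneg (sub_nonneg.mpr hn1) (sq_nonneg G)]

theorem exists_symmetral_subset_closedBall {n : ℕ} (hn : 2 ≤ n) {K : Set (Euc n)}
    (hK : IsCompact K) (hc : Convex ℝ K) (hvol : volume K = volume (closedBall (0 : Euc n) 1)) :
    ∃ (N : ℕ) (K' : Set (Euc n)), N ≤ 2 * n ∧ IsIteratedSymmetral N K K' ∧
      K' ⊆ closedBall 0 (2 * n ^ 2) ∧ ∀ x ∈ K', -x ∈ K' := by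
  have hn' : (0 : ℝ) < n := by positivity
  let b := EuclideanSpace.basisFun (Fin n) ℝ
  obtain ⟨K₁, h₁, hinv⟩ := exists_reflection_invariant_symmetral b hK hc Finset.univ
  replace hinv := fun i => hinv i (Finset.mem_univ i)
  obtain ⟨hk₁, hc₁, hv₁⟩ := h₁.isCompact_convex_volume hK hc
  obtain ⟨a, ha, hsub, hprod⟩ := exists_subset_frameBox b (by omega) hk₁ hc₁ (hv₁.trans hvol) hinv
  obtain ⟨N, K', b', hN, h', hb', hsub'⟩ := exists_symmetral_subset_frameBox
    (G := 2 * n) (by positivity) Finset.univ b.orthonormal ha (by simp) (by simpa using hprod)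
    hk₁ hc₁ hsub
  refine ⟨_, K', ?_, h₁.trans h', ?_, ?_⟩
  · simp at hN ⊢
    omega
  · refine hsub'.trans ((frameBox_subset_closedBall (by omega) hb' (by positivity)).trans_eq ?_)
    congr 1
    ring
  · exact (h'.preserves (P := fun L => ∀ x ∈ L, -x ∈ L)
      (fun _ hu _ hL hcL h => steinerSymmetral_neg_mem hu hL hcL h) hk₁ hc₁
      fun x hx => neg_mem_of_reflection_invariant b hc₁ hinv hx).2.2

/-- A symmetric convex body of the volume of the unit ball which is contained in a ball of radius
`R` contains the open ball of radius `R / (n * R) ^ n`. -/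
theorem le_norm_of_notMem {n : ℕ} (hn : 2 ≤ n) {K : Set (Euc n)} (hK : IsCompact K)
    (hc : Convex ℝ K) (hvol : volume K = volume (closedBall (0 : Euc n) 1))
    (hsymm : ∀ x ∈ K, -x ∈ K) {R : ℝ} (hR : 0 < R) (hKR : K ⊆ closedBall 0 R)
    {q : Euc n} (hq : q ∉ K) : R / (n * R) ^ n ≤ ‖q‖ := by
  have hn' : (0 : ℝ) < n := by positivity
  obtain ⟨f, t, hf, hft⟩ := geometric_hahn_banach_closed_point hc hK.isClosed hq
  set ν := (InnerProductSpace.toDual ℝ (Euc n)).symm f with hν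
  have hfν : ∀ x, f x = ⟪ν, x⟫ := fun x => by
    rw [hν, InnerProductSpace.toDual_symm_apply]
  have habs : ∀ x ∈ K, |⟪ν, x⟫| ≤ ‖ν‖ * ‖q‖ := fun x hx => by
    have h1 := hf x hx
    have h2 := hf _ (hsymm x hx)
    rw [hfν] at h1 h2 hft
    rw [inner_neg_right] at h2
    have := real_inner_le_norm ν q
    exact abs_le'.mpr ⟨by linarith, by linarith⟩
  have hν0 : 0 < ‖ν‖ := by
    rw [norm_pos_iff]
    intro h0
    have hne : K.Nonempty :=
      nonempty_of_measure_ne_zero (hvol ▸ measure_closedBall_pos _ _ one_pos).ne'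
    obtain ⟨x, hx⟩ := hne
    have h1 := hf x hx
    rw [hfν, h0, inner_zero_left] at h1 hft
    exact lt_asymm h1 hft
  set u := ‖ν‖⁻¹ • ν with hudef
  have hu : ‖u‖ = 1 := by
    rw [hudef, norm_smul, norm_inv, norm_norm, inv_mul_cancel₀ hν0.ne']
  have huK : ∀ x ∈ K, |⟪u, x⟫| ≤ ‖q‖ := fun x hx => by
    rw [hudef, real_inner_smul_left, abs_mul, abs_of_pos (inv_pos.mpr hν0),
      inv_mul_le_iff₀ hν0]
    exact habs x hx
  let i₀ : Fin n := ⟨0, by omega⟩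
  obtain ⟨b, hb⟩ := Orthonormal.exists_orthonormalBasis_extension_of_card_eq
    (𝕜 := ℝ) (E := Euc n) (ι := Fin n) (by simp) (v := fun _ => u) (s := {i₀})
    (by
      constructor
      · intro i; simpa using hu
      · intro i j hij
        exact absurd (Subsingleton.elim i j) hij)
  have hb0 : b i₀ = u := hb i₀ rfl
  have hsub : K ⊆ frameBox b (Function.update (fun _ => R) i₀ ‖q‖) := fun x hx i => by
    rcases eq_or_ne i i₀ with rfl | hi
    · rw [Function.update_self, hb0]
      exact huK x hx
    · rw [Function.update_of_ne hi]
      have := abs_real_inner_le_norm (b i) x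
      rw [b.orthonormal.1 i, one_mul] at this
      exact this.trans (mem_closedBall_zero_iff.mp (hKR hx))
  have hball := frameBox_subset_closedBall (by omega) b.orthonormal
    (G := (n : ℝ)⁻¹) (by positivity)
  rw [mul_inv_cancel₀ hn'.ne'] at hball
  have hv := (measure_mono hball).trans (hvol.ge.trans (measure_mono hsub))
  rw [volume_frameBox, volume_frameBox, ← ENNReal.ofReal_prod_of_nonneg,
    ← ENNReal.ofReal_prod_of_nonneg, ENNReal.ofReal_le_ofReal_iff] at hv
  · rw [Finset.prod_mul_distrib, Finset.prod_mul_distrib,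
      Finset.prod_update_of_mem (Finset.mem_univ _)] at hv
    have hv' := le_of_mul_le_mul_left hv (by positivity)
    rw [Finset.prod_const, Finset.prod_const, Finset.card_univ, Fintype.card_fin,
      Finset.card_sdiff_of_subset (Finset.subset_univ _), Finset.card_univ, Fintype.card_fin,
      Finset.card_singleton] at hv'
    rw [div_le_iff₀ (by positivity), mul_pow]
    have h1 : (n : ℝ)⁻¹ ^ n * n ^ n = 1 := by
      rw [← mul_pow, inv_mul_cancel₀ hn'.ne', one_pow]
    have h2 : R ^ (n - 1) * R = R ^ n := by rw [← pow_succ]; congr 1; omega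
    calc R = (n : ℝ)⁻¹ ^ n * (n ^ n * R) := by rw [← mul_assoc, h1, one_mul]
      _ ≤ ‖q‖ * R ^ (n - 1) * (n ^ n * R) := by gcongr
      _ = ‖q‖ * (n ^ n * (R ^ (n - 1) * R)) := by ring
      _ = _ := by rw [h2]
  · refine Finset.prod_nonneg fun i _ => ?_
    rcases eq_or_ne i i₀ with rfl | hi
    · rw [Function.update_self]; positivity
    · rw [Function.update_of_ne hi]; positivity
  · intro i _
    rcases eq_or_ne i i₀ with rfl | hi
    · rw [Function.update_self]; positivity
    · rw [Function.update_of_ne hi]; positivity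
  · intro i _
    positivity

theorem volume_closedBall_zero {n : ℕ} {r : ℝ} (hr : 0 ≤ r) :
    volume (closedBall (0 : Euc n) r) =
      ENNReal.ofReal (r ^ n) * volume (closedBall (0 : Euc n) 1) := by
  rw [Measure.addHaar_closedBall' _ _ hr]
  simp

theorem exists_mem_notMem_of_not_sandwiched {n : ℕ} (hn : 2 ≤ n) {K : Set (Euc n)}
    (hvol : volume K = volume (closedBall (0 : Euc n) 1)) {ε : ℝ} (hε : 0 < ε) (hε' : ε < 1 / 2)
    (hnot : ¬ ((1 - ε) • closedBall (0 : Euc n) 1 ⊆ K ∧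
      K ⊆ (1 + ε) • closedBall (0 : Euc n) 1)) :
    ∃ p ∈ K, ∃ q ∉ K, ‖q‖ + ε / 2 ≤ ‖p‖ := by
  have hD0 : volume (closedBall (0 : Euc n) 1) ≠ 0 := (measure_closedBall_pos _ _ one_pos).ne'
  have hDt : volume (closedBall (0 : Euc n) 1) ≠ ∞ := measure_closedBall_lt_top.ne
  rw [_root_.smul_closedBall _ _ zero_le_one, _root_.smul_closedBall _ _ zero_le_one, smul_zero, smul_zero,
    mul_one, mul_one, Real.norm_eq_abs, Real.norm_eq_abs, abs_of_pos (by linarith),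
    abs_of_pos (by linarith)] at hnot
  rcases not_and_or.mp hnot with h | h
  · obtain ⟨q, hq, hqK⟩ := Set.not_subset.mp h
    rw [mem_closedBall_zero_iff] at hq
    by_contra! hcon
    have hsub : K ⊆ closedBall 0 (1 - ε / 2) := fun x hx => by
      have := hcon x hx q hqK
      rw [mem_closedBall_zero_iff]
      linarith
    have hv := hvol.ge.trans (measure_mono hsub)
    rw [volume_closedBall_zero (r := 1 - ε / 2) (by linarith)] at hv
    have hlt : (1 - ε / 2) ^ n < 1 := pow_lt_one₀ (by linarith) (by linarith) (by omega)
    refine hv.not_gt ?_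
    calc _ < 1 * volume (closedBall (0 : Euc n) 1) :=
          ENNReal.mul_lt_mul_left hD0 hDt (by simpa using hlt)
      _ = _ := one_mul _
  · obtain ⟨p, hp, hpK⟩ := Set.not_subset.mp h
    rw [mem_closedBall_zero_iff, not_le] at hpK
    by_contra! hcon
    have hsub : closedBall 0 (1 + ε / 2) ⊆ K := fun x hx => by
      by_contra hxK
      have := hcon p hp x hxK
      rw [mem_closedBall_zero_iff] at hx
      linarith
    have hv := (measure_mono hsub).trans hvol.le
    rw [volume_closedBall_zero (r := 1 + ε / 2) (by linarith)] at hv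
    have hlt : 1 < (1 + ε / 2) ^ n := one_lt_pow₀ (by linarith) (by omega)
    refine hv.not_gt ?_
    calc _ = 1 * volume (closedBall (0 : Euc n) 1) := (one_mul _).symm
      _ < _ := ENNReal.mul_lt_mul_left hD0 hDt (by simpa using hlt)

theorem exists_reflection_eq {n : ℕ} {x y : Euc n} (hxy : ‖x‖ = ‖y‖) (hne : x ≠ y) :
    ∃ u : Euc n, ‖u‖ = 1 ∧ x - (2 * ⟪u, x⟫) • u = y := by
  have hd : 0 < ‖x - y‖ := norm_pos_iff.mpr (sub_ne_zero.mpr hne)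
  refine ⟨‖x - y‖⁻¹ • (x - y), ?_, ?_⟩
  · rw [norm_smul, norm_inv, norm_norm, inv_mul_cancel₀ hd.ne']
  · have h1 : 2 * ⟪x - y, x⟫ = ‖x - y‖ ^ 2 := by
      rw [norm_sub_sq_real, inner_sub_left, real_inner_self_eq_norm_sq, ← hxy, real_inner_comm]
      ring
    rw [real_inner_smul_left, smul_smul,
      show 2 * (‖x - y‖⁻¹ * ⟪x - y, x⟫) * ‖x - y‖⁻¹ = 1 by
        rw [show 2 * (‖x - y‖⁻¹ * ⟪x - y, x⟫) * ‖x - y‖⁻¹ =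
          2 * ⟪x - y, x⟫ * ‖x - y‖⁻¹ ^ 2 by ring, h1]
        field_simp]
    rw [one_smul, sub_sub_cancel]

/-- A body that is not close to the unit ball loses a definite amount of its second moment under
a suitable Steiner symmetrization. -/
theorem exists_dirMoment_drop {n : ℕ} (hn : 2 ≤ n) {K : Set (Euc n)} (hK : IsCompact K)
    (hc : Convex ℝ K) (hvol : volume K = volume (closedBall (0 : Euc n) 1))
    (hsymm : ∀ x ∈ K, -x ∈ K) {R : ℝ} (hR : 1 ≤ R) (hKR : K ⊆ closedBall 0 R)
    {ε : ℝ} (hε : 0 < ε) (hε' : ε < 1 / 2)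
    (hnot : ¬ ((1 - ε) • closedBall (0 : Euc n) 1 ⊆ K ∧
      K ⊆ (1 + ε) • closedBall (0 : Euc n) 1))
    {r c : ℝ} (hr : r = R / (n * R) ^ n) (hcr : c = ε * r / (4 * R)) :
    ∃ u : Euc n, ‖u‖ = 1 ∧ dirMoment u (steinerSymmetral u K) +
      ENNReal.ofReal (c ^ 2 / 4 * (c / (2 * R) * r) ^ n) * volume (closedBall (0 : Euc n) 1) ≤
      dirMoment u K := by
  have hn' : (2 : ℝ) ≤ n := by exact_mod_cast hn
  have hR0 : 0 < R := by linarith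
  have hr0 : 0 < r := by rw [hr]; positivity
  have hrR : r ≤ R := by
    rw [hr]
    exact div_le_self hR0.le (one_le_pow₀ (by nlinarith))
  have hc0 : 0 < c := by rw [hcr]; positivity
  have hcR : c * (4 * R) = ε * r := by rw [hcr]; field_simp
  have hcR' : c ≤ R := by nlinarith
  have hball : ∀ x : Euc n, ‖x‖ < r → x ∈ K := fun x hx => by
    by_contra hxK
    have := le_norm_of_notMem hn hK hc hvol hsymm hR0 hKR hxK
    rw [← hr] at this
    linarith
  have h0K : (0 : Euc n) ∈ K := hball 0 (by simpa)
  obtain ⟨p, hp, q, hq, hpq⟩ := exists_mem_notMem_of_not_sandwiched hn hvol hε hε' hnot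
  have hpR : ‖p‖ ≤ R := mem_closedBall_zero_iff.mp (hKR hp)
  have hp0 : 0 < ‖p‖ := by linarith [norm_nonneg q]
  set κ := ‖q‖ / ‖p‖ with hκ
  have hκ0 : 0 ≤ κ := by positivity
  have hκ1 : ε / (2 * R) ≤ 1 - κ := by
    have h1 : 1 - κ = (‖p‖ - ‖q‖) / ‖p‖ := by rw [hκ]; field_simp
    rw [h1, div_le_div_iff₀ (by positivity) hp0]
    nlinarith
  have hκlt : 0 < 1 - κ := lt_of_lt_of_le (by positivity) hκ1
  have hκr : 2 * c ≤ (1 - κ) * r := by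
    calc 2 * c = ε / (2 * R) * r := by rw [hcr]; field_simp; ring
      _ ≤ _ := by gcongr
  have hnorm : ‖κ • p‖ = ‖q‖ := by
    rw [norm_smul, Real.norm_of_nonneg hκ0, hκ]
    field_simp
  have hne : κ • p ≠ q := by
    intro heq
    rw [← heq] at hq
    exact hq (by simpa using hc hp h0K hκ0 hκlt.le (by ring))
  obtain ⟨u, hu, hrefl⟩ := exists_reflection_eq hnorm hne
  refine ⟨u, hu, ?_⟩
  set l := c / (2 * R) with hl
  have hl0 : 0 < l := by positivity
  have hlR : l * (2 * R) = c := by rw [hl]; field_simp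
  have hl1 : l ≤ 1 := by nlinarith
  have hB : ∀ x ∈ ball ((1 - l) • p) (l * r), x ∈ K ∧ ‖x - p‖ ≤ c := fun x hx => by
    rw [mem_ball_iff_norm] at hx
    set w := l⁻¹ • (x - (1 - l) • p) with hw
    have hwr : ‖w‖ < r := by
      rw [hw, norm_smul, norm_inv, Real.norm_of_nonneg hl0.le, inv_mul_lt_iff₀ hl0]
      exact hx
    have hx' : x = (1 - l) • p + l • w := by
      rw [hw, smul_inv_smul₀ hl0.ne']
      abel
    have hmem : x ∈ K := by
      rw [hx']
      exact hc hp (hball w hwr) (by linarith) hl0.le (by ring)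
    refine ⟨hmem, ?_⟩
    have : x - p = l • (w - p) := by
      rw [smul_sub, hw, smul_inv_smul₀ hl0.ne']
      module
    rw [this, norm_smul, Real.norm_of_nonneg hl0.le]
    have := norm_sub_le w p
    nlinarith
  have key : ∀ x ∈ ball ((1 - l) • p) (l * r), ∀ τ : ℝ, x + τ • u ∈ K →
      c ≤ |2 * ⟪u, x⟫ + τ| := fun x hx τ hτ => by
    by_contra! hlt
    set m := 2 * ⟪u, x⟫ + τ with hm
    have hxp := (hB x hx).2
    set e := (p - x - (2 * ⟪u, p - x⟫) • u) - m • u with he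
    have hnr : ‖p - x - (2 * ⟪u, p - x⟫) • u‖ = ‖x - p‖ := by
      rw [norm_sub_rev x p, ← sq_eq_sq₀ (norm_nonneg _) (norm_nonneg _), norm_sub_sq_real,
        norm_smul, real_inner_smul_right, hu, real_inner_comm, Real.norm_eq_abs, mul_one, sq_abs]
      ring
    have hen : ‖e‖ < 2 * c := by
      calc ‖e‖ ≤ ‖x - p‖ + ‖m • u‖ := hnr ▸ norm_sub_le _ _
        _ < 2 * c := by
          rw [norm_smul, hu, mul_one, Real.norm_eq_abs]
          linarith
    have hq' : q = κ • (x + τ • u) + (1 - κ) • ((1 - κ)⁻¹ • κ • e) := by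
      rw [smul_inv_smul₀ hκlt.ne', ← hrefl, he, hm, inner_sub_right, real_inner_smul_right]
      module
    rw [hq'] at hq
    refine hq (hc hτ (hball _ ?_) hκ0 hκlt.le (by ring))
    rw [norm_smul, norm_smul, norm_inv, Real.norm_of_nonneg hκlt.le, Real.norm_of_nonneg hκ0,
      inv_mul_lt_iff₀ hκlt]
    nlinarith [norm_nonneg e]
  have := dirMoment_steinerSymmetral_add_le hu hK hc measurableSet_ball (fun x hx => (hB x hx).1)
    hc0 key
  rwa [Measure.addHaar_ball_of_pos _ _ (by positivity), ← Measure.addHaar_unitClosedBall_eq_addHaar_unitBall,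
    ← mul_assoc, ← ENNReal.ofReal_mul (by positivity), finrank_euclideanSpace_fin] at this

theorem secondMoment_ne_top {n : ℕ} {K : Set (Euc n)} (hK : IsCompact K) :
    secondMoment K ≠ ∞ := by
  obtain ⟨R, hR⟩ := hK.isBounded.subset_closedBall 0
  exact ((secondMoment_le hR).trans_lt
    (ENNReal.mul_lt_top ENNReal.ofReal_lt_top hK.measure_lt_top)).ne

theorem dirMoment_ne_top {n : ℕ} {u : Euc n} (hu : ‖u‖ = 1) {K : Set (Euc n)}
    (hK : IsCompact K) : dirMoment u K ≠ ∞ := by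
  refine ne_top_of_le_ne_top (secondMoment_ne_top hK) (lintegral_mono fun x => ?_)
  refine ENNReal.ofReal_le_ofReal (sq_le_sq' ?_ ?_)
  · have := abs_real_inner_le_norm u x
    rw [hu, one_mul] at this
    exact (abs_le.mp this).1
  · have := abs_real_inner_le_norm u x
    rw [hu, one_mul] at this
    exact (abs_le.mp this).2

/-- The infimum of the second moments of all iterated Steiner symmetrals of `K`. -/
noncomputable def infSecondMoment {n : ℕ} (K : Set (Euc n)) : ℝ≥0∞ :=
  sInf {m | ∃ N K', IsIteratedSymmetral N K K' ∧ secondMoment K' = m}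

/-- The amount by which the second moment of `K` can be decreased by Steiner symmetrizations. -/
noncomputable def momentGap {n : ℕ} (K : Set (Euc n)) : ℝ :=
  (secondMoment K).toReal - (infSecondMoment K).toReal

theorem infSecondMoment_le {n N : ℕ} {K K' : Set (Euc n)} (h : IsIteratedSymmetral N K K') :
    infSecondMoment K ≤ secondMoment K' :=
  sInf_le ⟨N, K', h, rfl⟩

theorem infSecondMoment_steinerSymmetral {n : ℕ} {u : Euc n} (hu : ‖u‖ = 1) (K : Set (Euc n)) :
    infSecondMoment K ≤ infSecondMoment (steinerSymmetral u K) := by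
  refine le_sInf ?_
  rintro _ ⟨N, K', h, rfl⟩
  exact infSecondMoment_le ((IsIteratedSymmetral.single hu K).trans h)

theorem toReal_secondMoment_sub {n : ℕ} {u : Euc n} (hu : ‖u‖ = 1) {K : Set (Euc n)}
    (hK : IsCompact K) (hc : Convex ℝ K) :
    (secondMoment K).toReal - (secondMoment (steinerSymmetral u K)).toReal =
      (dirMoment u K).toReal - (dirMoment u (steinerSymmetral u K)).toReal := by
  have hS := isCompact_steinerSymmetral hu hK hc
  have := congrArg ENNReal.toReal (secondMoment_steinerSymmetral_add hu hK hc)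
  rw [ENNReal.toReal_add (secondMoment_ne_top hS) (dirMoment_ne_top hu hK),
    ENNReal.toReal_add (secondMoment_ne_top hK) (dirMoment_ne_top hu hS)] at this
  linarith

theorem infSecondMoment_ne_top {n : ℕ} {K : Set (Euc n)} (hK : IsCompact K) :
    infSecondMoment K ≠ ∞ :=
  ne_top_of_le_ne_top (secondMoment_ne_top hK) (infSecondMoment_le (.refl K))

theorem momentGap_nonneg {n : ℕ} {K : Set (Euc n)} (hK : IsCompact K) : 0 ≤ momentGap K :=
  sub_nonneg.mpr (ENNReal.toReal_mono (secondMoment_ne_top hK) (infSecondMoment_le (.refl K)))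

theorem dirMoment_sub_le_momentGap {n : ℕ} {u : Euc n} (hu : ‖u‖ = 1) {K : Set (Euc n)}
    (hK : IsCompact K) (hc : Convex ℝ K) :
    (dirMoment u K).toReal - (dirMoment u (steinerSymmetral u K)).toReal ≤ momentGap K := by
  rw [← toReal_secondMoment_sub hu hK hc, momentGap]
  have := ENNReal.toReal_mono
    (secondMoment_ne_top (isCompact_steinerSymmetral hu hK hc))
    (infSecondMoment_le (IsIteratedSymmetral.single hu K))
  linarith

theorem momentGap_steinerSymmetral_le {n : ℕ} {u : Euc n} (hu : ‖u‖ = 1) {K : Set (Euc n)}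
    (hK : IsCompact K) (hc : Convex ℝ K) :
    momentGap (steinerSymmetral u K) ≤ momentGap K -
      ((dirMoment u K).toReal - (dirMoment u (steinerSymmetral u K)).toReal) := by
  rw [← toReal_secondMoment_sub hu hK hc, momentGap, momentGap]
  have := ENNReal.toReal_mono (infSecondMoment_ne_top (isCompact_steinerSymmetral hu hK hc))
    (infSecondMoment_steinerSymmetral hu K)
  linarith

theorem exists_momentGap_steinerSymmetral_le {n : ℕ} (hn : 2 ≤ n) {K : Set (Euc n)}
    (hK : IsCompact K) (hc : Convex ℝ K) :
    ∃ u : Euc n, ‖u‖ = 1 ∧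
      momentGap (steinerSymmetral u K) ≤ (1 - 1 / (2 * n)) * momentGap K := by
  have hn0 : (0 : ℝ) < n := by positivity
  have hg := momentGap_nonneg hK
  have hδ : 0 ≤ momentGap K / (2 * n) := by positivity
  suffices ∃ u : Euc n, ‖u‖ = 1 ∧ momentGap K / (2 * n) ≤
      (dirMoment u K).toReal - (dirMoment u (steinerSymmetral u K)).toReal by
    obtain ⟨u, hu, h⟩ := this
    refine ⟨u, hu, (momentGap_steinerSymmetral_le hu hK hc).trans ?_⟩
    calc _ ≤ momentGap K - momentGap K / (2 * n) := by linarith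
      _ = _ := by ring
  by_contra! hcon
  have hle : ∀ u : Euc n, ‖u‖ = 1 → dirMoment u K ≤
      dirMoment u (steinerSymmetral u K) + ENNReal.ofReal (momentGap K / (2 * n)) := fun u hu => by
    have h1 := dirMoment_ne_top hu hK
    have h2 := dirMoment_ne_top hu (isCompact_steinerSymmetral hu hK hc)
    rw [← ENNReal.toReal_le_toReal h1 (by finiteness), ENNReal.toReal_add h2 (by finiteness),
      ENNReal.toReal_ofReal hδ]
    linarith [hcon u hu]
  have hinf : secondMoment K ≤ infSecondMoment K +
      n * ENNReal.ofReal (momentGap K / (2 * n)) := by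
    rw [infSecondMoment, ENNReal.sInf_add]
    refine le_iInf₂ ?_
    rintro _ ⟨N, K', h, rfl⟩
    obtain ⟨hK', hc', hJ⟩ := h.preserves (P := fun L => rieszEnergy K ≤ rieszEnergy L)
      (fun _ hu _ hL hcL hJ => hJ.trans (rieszEnergy_le_steinerSymmetral hu hL hcL)) hK hc le_rfl
    exact secondMoment_le_of_forall_dirMoment_le hn hK hc hK' hc' hJ hle
  have hI := infSecondMoment_ne_top hK
  have := ENNReal.toReal_mono (by finiteness) hinf
  rw [ENNReal.toReal_add hI (by finiteness), ENNReal.toReal_mul, ENNReal.toReal_ofReal hδ,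
    ENNReal.toReal_natCast] at this
  have hhalf : (n : ℝ) * (momentGap K / (2 * n)) = momentGap K / 2 := by field_simp
  have h0 : momentGap K = 0 := by
    rw [hhalf] at this
    have hdef : momentGap K = (secondMoment K).toReal - (infSecondMoment K).toReal := rfl
    linarith
  let u : Euc n := EuclideanSpace.single ⟨0, by omega⟩ 1
  have hu : ‖u‖ = 1 := by simp [u]
  have h1 := hcon u hu
  have h2 := ENNReal.toReal_mono (dirMoment_ne_top hu hK) (dirMoment_steinerSymmetral_le hu hK hc)
  rw [h0, zero_div] at h1
  linarith

theorem exists_isIteratedSymmetral_momentGap_le {n : ℕ} (hn : 2 ≤ n) (N : ℕ) {K : Set (Euc n)}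
    (hK : IsCompact K) (hc : Convex ℝ K) :
    ∃ K', IsIteratedSymmetral N K K' ∧ momentGap K' ≤ (1 - 1 / (2 * n)) ^ N * momentGap K := by
  induction N with
  | zero => exact ⟨K, .refl K, by simp⟩
  | succ N ih =>
    obtain ⟨K', h, hle⟩ := ih
    obtain ⟨hK', hc', -⟩ := h.isCompact_convex_volume hK hc
    obtain ⟨u, hu, hgap⟩ := exists_momentGap_steinerSymmetral_le hn hK' hc'
    refine ⟨_, h.trans (.single hu K'), hgap.trans ?_⟩
    have : (1 : ℝ) / (2 * n) ≤ 1 := by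
      have : (2 : ℝ) ≤ n := by exact_mod_cast hn
      rw [div_le_one (by positivity)]
      linarith
    calc _ ≤ (1 - 1 / (2 * (n : ℝ))) * ((1 - 1 / (2 * n)) ^ N * momentGap K) := by
          gcongr
      _ = _ := by ring

theorem sandwiched_of_momentGap_lt {n : ℕ} (hn : 2 ≤ n) {K : Set (Euc n)} (hK : IsCompact K)
    (hc : Convex ℝ K) (hvol : volume K = volume (closedBall (0 : Euc n) 1))
    (hsymm : ∀ x ∈ K, -x ∈ K) {R : ℝ} (hR : 1 ≤ R) (hKR : K ⊆ closedBall 0 R)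
    {ε : ℝ} (hε : 0 < ε) (hε' : ε < 1 / 2)
    {r c : ℝ} (hr : r = R / (n * R) ^ n) (hcr : c = ε * r / (4 * R))
    (hgap : momentGap K < c ^ 2 / 4 * (c / (2 * R) * r) ^ n *
      (volume (closedBall (0 : Euc n) 1)).toReal) :
    (1 - ε) • closedBall (0 : Euc n) 1 ⊆ K ∧ K ⊆ (1 + ε) • closedBall (0 : Euc n) 1 := by
  by_contra hnot
  obtain ⟨u, hu, h⟩ := exists_dirMoment_drop hn hK hc hvol hsymm hR hKR hε hε' hnot hr hcr
  have hS := dirMoment_ne_top hu (isCompact_steinerSymmetral hu hK hc)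
  have hD : volume (closedBall (0 : Euc n) 1) ≠ ∞ := measure_closedBall_lt_top.ne
  have hr0 : 0 < r := by rw [hr]; positivity
  have hc0 : 0 < c := by rw [hcr]; positivity
  have := ENNReal.toReal_mono (dirMoment_ne_top hu hK) h
  rw [ENNReal.toReal_add hS (by finiteness), ENNReal.toReal_mul,
    ENNReal.toReal_ofReal (by positivity)] at this
  linarith [dirMoment_sub_le_momentGap hu hK hc]

theorem pow_mul_sq_lt_drop {n : ℕ} (hn : 2 ≤ n) {ε : ℝ} (hε : 0 < ε) (hε' : ε < 1 / 2) {N : ℕ}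
    (hN : 48 * (n : ℝ) ^ 4 + 4 * n ^ 2 * (-Real.log ε) < N) {R r c : ℝ} (hR : R = 2 * n ^ 2)
    (hr : r = R / (n * R) ^ n) (hcr : c = ε * r / (4 * R)) :
    (1 - 1 / (2 * n) : ℝ) ^ N * R ^ 2 < c ^ 2 / 4 * (c / (2 * R) * r) ^ n := by
  have hn2 : (2 : ℝ) ≤ n := by exact_mod_cast hn
  have hn0 : (0 : ℝ) < n := by linarith
  have hR0 : 0 < R := by rw [hR]; positivity
  obtain ⟨t, ht⟩ : ∃ t : ℝ, t = (2 * (n : ℝ))⁻¹ := ⟨_, rfl⟩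
  have ht0 : 0 < t := by rw [ht]; positivity
  have htn : t * n = 1 / 2 := by rw [ht]; field_simp
  have ht4 : t ≤ 1 / 4 := by nlinarith
  have htR : t ^ 2 * R = 1 / 2 := by
    rw [hR, show t ^ 2 * (2 * (n : ℝ) ^ 2) = 2 * (t * n) ^ 2 by ring, htn]; norm_num
  have hrR : t ^ (3 * n) ≤ r / R := by
    have h1 : r / R = ((n * R)⁻¹) ^ n := by rw [hr, inv_pow]; field_simp
    rw [h1, pow_mul]
    gcongr
    rw [le_inv_comm₀ (by positivity) (by positivity)]
    refine le_of_mul_le_mul_left ?_ (by positivity : 0 < t ^ 3)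
    rw [mul_inv_cancel₀ (by positivity)]
    calc t ^ 3 * (n * R) = (t * n) * (t ^ 2 * R) := by ring
      _ ≤ 1 := by rw [htn, htR]; norm_num
  have hr0 : 0 < r := by rw [hr]; positivity
  have hc0 : 0 < c := by rw [hcr]; positivity
  have hc1 : ε * t ^ (3 * n + 1) ≤ c := by
    calc ε * t ^ (3 * n + 1) = ε * (t ^ (3 * n) * t) := by rw [pow_succ]
      _ ≤ ε * ((r / R) * (1 / 4)) := by gcongr
      _ = c := by rw [hcr]; field_simp
  have hc2 : ε * t ^ (6 * n + 2) ≤ c / (2 * R) * r := by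
    calc ε * t ^ (6 * n + 2) = (ε * t ^ (3 * n + 1)) * (t * t ^ (3 * n)) := by ring
      _ ≤ c * ((1 / 2) * (r / R)) := by gcongr; linarith
      _ = _ := by field_simp
  have hc3 : ε ^ 2 * t ^ (6 * n + 3) ≤ c ^ 2 / 4 := by
    calc ε ^ 2 * t ^ (6 * n + 3) = (ε * t ^ (3 * n + 1)) ^ 2 * t := by ring
      _ ≤ c ^ 2 * (1 / 4) := by gcongr
      _ = _ := by ring
  have hlow : ε ^ (2 * n) * t ^ (12 * n ^ 2) ≤
      (ε ^ 2 * t ^ (6 * n + 3)) * (ε * t ^ (6 * n + 2)) ^ n * t ^ 4 := by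
    calc ε ^ (2 * n) * t ^ (12 * n ^ 2)
        ≤ ε ^ (n + 2) * t ^ (6 * n + 3 + (6 * n + 2) * n + 4) := by
          gcongr ?_ * ?_
          · exact pow_le_pow_of_le_one hε.le (by linarith) (by omega)
          · exact pow_le_pow_of_le_one ht0.le (by linarith) (by nlinarith)
      _ = _ := by ring
  have hpow : (1 - 1 / (2 * n) : ℝ) ^ N < ε ^ (2 * n) * t ^ (12 * n ^ 2) := by
    have h1 : (1 - 1 / (2 * n) : ℝ) ^ N ≤ Real.exp (-(N * t)) := by
      rw [show -(N * t) = N * -t by ring, Real.exp_nat_mul]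
      refine pow_le_pow_left₀ ?_ ?_ N
      · rw [one_div, ← ht]; linarith
      · rw [one_div, ← ht]
        linarith [Real.add_one_le_exp (-t)]
    have h2 : ε ^ (2 * n) = Real.exp ((2 * n : ℕ) * Real.log ε) := by
      rw [Real.exp_nat_mul, Real.exp_log hε]
    have h3 : Real.exp (-(2 * n)) ≤ t := by
      rw [ht, Real.exp_neg]
      gcongr
      linarith [Real.add_one_le_exp (2 * (n : ℝ))]
    have h4 : Real.exp ((12 * n ^ 2 : ℕ) * (-(2 * n))) ≤ t ^ (12 * n ^ 2) := by
      rw [Real.exp_nat_mul]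
      gcongr
    refine h1.trans_lt ?_
    calc Real.exp (-(N * t))
        < Real.exp ((2 * n : ℕ) * Real.log ε + (12 * n ^ 2 : ℕ) * (-(2 * n))) := by
          rw [Real.exp_lt_exp]
          push_cast
          have := mul_lt_mul_of_pos_right hN ht0
          have h5 : (48 * (n : ℝ) ^ 4 + 4 * n ^ 2 * (-Real.log ε)) * t =
              (48 * n ^ 3 - 4 * n * Real.log ε) * (t * n) := by ring
          rw [h5, htn] at this
          nlinarith
      _ ≤ _ := by
          rw [Real.exp_add, h2]
          gcongr
  calc (1 - 1 / (2 * n) : ℝ) ^ N * R ^ 2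
      < ((ε ^ 2 * t ^ (6 * n + 3)) * (ε * t ^ (6 * n + 2)) ^ n * t ^ 4) * R ^ 2 := by
        gcongr
        exact hpow.trans_le hlow
    _ = (ε ^ 2 * t ^ (6 * n + 3)) * (ε * t ^ (6 * n + 2)) ^ n * (t ^ 2 * R) ^ 2 := by ring
    _ ≤ (ε ^ 2 * t ^ (6 * n + 3)) * (ε * t ^ (6 * n + 2)) ^ n * 1 := by
        rw [htR]
        gcongr
        norm_num
    _ ≤ _ := by
        rw [mul_one]
        gcongr

theorem exists_isIteratedSymmetral_sandwiched {n : ℕ} (hn : 2 ≤ n) {K : Set (Euc n)}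
    (hK : IsCompact K) (hc : Convex ℝ K) (hvol : volume K = volume (closedBall (0 : Euc n) 1))
    {ε : ℝ} (hε : 0 < ε) (hε' : ε < 1 / 2) :
    ∃ (N : ℕ) (K' : Set (Euc n)), (N : ℝ) ≤ 300 * (n : ℝ) ^ 4 * Real.log ε ^ 2 ∧
      IsIteratedSymmetral N K K' ∧
      (1 - ε) • closedBall (0 : Euc n) 1 ⊆ K' ∧ K' ⊆ (1 + ε) • closedBall (0 : Euc n) 1 := by
  have hn2 : (2 : ℝ) ≤ n := by exact_mod_cast hn
  obtain ⟨N₀, K₀, hN₀, h₀, hsub₀, hsymm₀⟩ := exists_symmetral_subset_closedBall hn hK hc hvol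
  obtain ⟨hK₀, hc₀, hv₀⟩ := h₀.isCompact_convex_volume hK hc
  rw [hvol] at hv₀
  have hlog : 1 / 2 < -Real.log ε := by
    have h1 := Real.log_lt_log hε hε'
    rw [one_div, Real.log_inv] at h1
    linarith [Real.log_two_gt_d9]
  set N := ⌊48 * (n : ℝ) ^ 4 + 4 * n ^ 2 * (-Real.log ε)⌋₊ + 1 with hN
  have hNlt : 48 * (n : ℝ) ^ 4 + 4 * n ^ 2 * (-Real.log ε) < N := by
    rw [hN]; push_cast; exact Nat.lt_floor_add_one _
  have hpos : 0 ≤ 48 * (n : ℝ) ^ 4 + 4 * n ^ 2 * (-Real.log ε) := by positivity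
  have hNle : (N : ℝ) ≤ 48 * (n : ℝ) ^ 4 + 4 * n ^ 2 * (-Real.log ε) + 1 := by
    rw [hN]; push_cast; linarith [Nat.floor_le hpos]
  obtain ⟨K', h', hgap⟩ := exists_isIteratedSymmetral_momentGap_le hn N hK₀ hc₀
  have hR1 : (1 : ℝ) ≤ 2 * n ^ 2 := by nlinarith
  obtain ⟨hK', hc', hv', hsymm', hsub'⟩ := h'.preserves
    (P := fun L => volume L = volume (closedBall (0 : Euc n) 1) ∧ (∀ x ∈ L, -x ∈ L) ∧
      L ⊆ closedBall 0 (2 * n ^ 2))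
    (fun _ hu _ hL hcL h => ⟨(volume_steinerSymmetral hu hL hcL).trans h.1,
      steinerSymmetral_neg_mem hu hL hcL h.2.1, steinerSymmetral_subset_closedBall hu hL hcL h.2.2⟩)
    hK₀ hc₀ ⟨hv₀, hsymm₀, hsub₀⟩
  refine ⟨N₀ + N, K', ?_, h₀.trans h', ?_⟩
  · have h0 : (N₀ : ℝ) ≤ 2 * n := by exact_mod_cast hN₀
    set l := -Real.log ε with hl
    have hl2 : Real.log ε ^ 2 = l ^ 2 := by rw [hl]; ring
    rw [hl2]
    push_cast
    have hn4 : (n : ℝ) ^ 2 ≤ n ^ 4 := pow_le_pow_right₀ (by linarith) (by norm_num)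
    have h2n : 2 * (n : ℝ) + 1 ≤ 2 * n ^ 4 := by nlinarith
    have hlsq : 1 ≤ 4 * l ^ 2 := by nlinarith
    have hll : l ≤ 2 * l ^ 2 := by nlinarith
    have hn40 : (0 : ℝ) < n ^ 4 := by positivity
    calc (N₀ : ℝ) + N ≤ 2 * n + (48 * (n : ℝ) ^ 4 + 4 * n ^ 2 * l + 1) := by linarith
      _ ≤ 50 * n ^ 4 * 1 + 4 * n ^ 4 * l := by nlinarith
      _ ≤ 50 * n ^ 4 * (4 * l ^ 2) + 4 * n ^ 4 * (2 * l ^ 2) := by gcongr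
      _ ≤ _ := by nlinarith [mul_nonneg hn40.le (sq_nonneg l)]
  · refine sandwiched_of_momentGap_lt hn hK' hc' hv' hsymm' hR1 hsub' hε hε' rfl rfl
      (hgap.trans_lt ?_)
    have hD : volume (closedBall (0 : Euc n) 1) ≠ ∞ := measure_closedBall_lt_top.ne
    have hD0 : 0 < (volume (closedBall (0 : Euc n) 1)).toReal :=
      ENNReal.toReal_pos (measure_closedBall_pos _ _ one_pos).ne' hD
    have hbase : (0 : ℝ) ≤ 1 - 1 / (2 * n) := by
      rw [sub_nonneg, div_le_one (by positivity)]
      linarith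
    have hI : momentGap K₀ ≤ (2 * (n : ℝ) ^ 2) ^ 2 * (volume (closedBall (0 : Euc n) 1)).toReal := by
      have h1 := ENNReal.toReal_mono (by rw [hv₀]; finiteness) (secondMoment_le hsub₀)
      rw [hv₀, ENNReal.toReal_mul, ENNReal.toReal_ofReal (by positivity)] at h1
      exact (sub_le_self _ ENNReal.toReal_nonneg).trans h1
    calc _ ≤ (1 - 1 / (2 * n) : ℝ) ^ N *
          ((2 * (n : ℝ) ^ 2) ^ 2 * (volume (closedBall (0 : Euc n) 1)).toReal) := by gcongr
      _ = ((1 - 1 / (2 * n) : ℝ) ^ N * (2 * (n : ℝ) ^ 2) ^ 2) *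
          (volume (closedBall (0 : Euc n) 1)).toReal := by ring
      _ < _ := mul_lt_mul_of_pos_right (pow_mul_sq_lt_drop hn hε hε' hNlt rfl rfl rfl) hD0

/-- Klartag's theorem: `C n⁴ (log ε)²` Steiner symmetrizations suffice to transform a
convex body of the ball's volume into a body between `(1-ε)D_n` and `(1+ε)D_n`. -/
theorem klartag_steiner_convergence :
    ∃ C : ℝ, 0 < C ∧ ∀ (n : ℕ), 2 ≤ n →
      ∀ K : Set (EuclideanSpace ℝ (Fin n)), IsCompact K → Convex ℝ K →
        volume K = volume (closedBall (0 : EuclideanSpace ℝ (Fin n)) 1) →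
        ∀ ε : ℝ, ε ∈ Set.Ioo (0 : ℝ) (1 / 2) →
          ∃ (N : ℕ) (u : Fin N → EuclideanSpace ℝ (Fin n)),
            (∀ i, ‖u i‖ = 1) ∧
            (N : ℝ) ≤ C * (n : ℝ) ^ 4 * Real.log ε ^ 2 ∧
            (1 - ε) • closedBall (0 : EuclideanSpace ℝ (Fin n)) 1 ⊆
              (List.ofFn u).foldl (fun S v => steinerSymmetral v S) K ∧
            (List.ofFn u).foldl (fun S v => steinerSymmetral v S) K ⊆
              (1 + ε) • closedBall (0 : EuclideanSpace ℝ (Fin n)) 1 := by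
  refine ⟨300, by norm_num, fun n hn K hK hc hvol ε hε => ?_⟩
  obtain ⟨N, K', hN, ⟨l, hlen, hl, rfl⟩, h⟩ :=
    exists_isIteratedSymmetral_sandwiched hn hK hc hvol hε.1 hε.2
  subst hlen
  refine ⟨l.length, l.get, fun i => hl _ (l.get_mem i), hN, ?_⟩
  rwa [List.ofFn_get]
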